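/- arXiv:1212.1698 — 10 statements merged into one kernel-verified Lean document; each statement's English description precedes it below -/
import Mathlib

section
/- Let (X,d) be a metric space with diam X ≤ 2, and define d_c on pairs (x,t) ∈ X × [0,∞) by d_c((x₁,t₁),(x₂,t₂)) = |t₁ − t₂| + min(t₁,t₂)·d(x₁,x₂). Then d_c satisfies the triangle inequality: for all x₁, x₂, x₃ ∈ X and all t₁, t₂, t₃ ≥ 0, d_c((x₁,t₁),(x₃,t₃)) ≤ d_c((x₁,t₁),(x₂,t₂)) + d_c((x₂,t₂),(x₃,t₃)). -/
open Metric

/-- The cone metric `d_c((x₁,t₁),(x₂,t₂)) = |t₁ - t₂| + min t₁ t₂ * d(x₁,x₂)` on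
`X × [0,∞)`, for a metric space of diameter at most 2, satisfies the triangle inequality. -/
theorem cone_metric_triangle (X : Type*) [MetricSpace X]
    (hX : EMetric.diam (Set.univ : Set X) ≤ 2)
    (x₁ x₂ x₃ : X) (t₁ t₂ t₃ : ℝ) (ht₁ : 0 ≤ t₁) (ht₂ : 0 ≤ t₂) (ht₃ : 0 ≤ t₃) :
    |t₁ - t₃| + min t₁ t₃ * dist x₁ x₃ ≤
      (|t₁ - t₂| + min t₁ t₂ * dist x₁ x₂) + (|t₂ - t₃| + min t₂ t₃ * dist x₂ x₃) := by
  have ha : dist x₁ x₃ ≤ 2 := by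
    have h : edist x₁ x₃ ≤ 2 :=
      (Metric.edist_le_ediam_of_mem (Set.mem_univ x₁) (Set.mem_univ x₃)).trans hX
    rw [edist_dist] at h
    have h2 : ENNReal.ofReal (dist x₁ x₃) ≤ ENNReal.ofReal 2 := by simpa using h
    exact (ENNReal.ofReal_le_ofReal_iff (by norm_num)).1 h2
  have htri := dist_triangle x₁ x₂ x₃
  have hb : 0 ≤ dist x₁ x₂ := dist_nonneg
  have hc : 0 ≤ dist x₂ x₃ := dist_nonneg
  rcases le_or_gt (min t₁ t₃) t₂ with h | h
  · have e1 : min t₁ t₃ * dist x₁ x₂ ≤ min t₁ t₂ * dist x₁ x₂ :=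
      mul_le_mul_of_nonneg_right (le_min (min_le_left _ _) h) hb
    have e2 : min t₁ t₃ * dist x₂ x₃ ≤ min t₂ t₃ * dist x₂ x₃ :=
      mul_le_mul_of_nonneg_right (le_min h (min_le_right _ _)) hc
    have e3 := mul_le_mul_of_nonneg_left htri (le_min ht₁ ht₃)
    have e4 := abs_sub_le t₁ t₂ t₃
    linarith
  · obtain ⟨h1, h3⟩ := lt_min_iff.1 h
    have e1 : |t₁ - t₃| = t₁ + t₃ - 2 * min t₁ t₃ := by
      rcases le_total t₁ t₃ with g | g
      · rw [min_eq_left g, abs_of_nonpos (by linarith)]; ring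
      · rw [min_eq_right g, abs_of_nonneg (by linarith)]; ring
    rw [e1, min_eq_right h1.le, min_eq_left h3.le, abs_of_pos (sub_pos.2 h1),
      abs_of_neg (sub_neg.2 h3)]
    have e3 := mul_le_mul_of_nonneg_left htri ht₂
    have e4 := mul_nonneg (sub_nonneg.2 h.le) (sub_nonneg.2 ha)
    linarith
end

section
/- Let (X,d) be a metric space with diam X ≤ 2, and let ρ be a pseudometric on X × [0,∞) (i.e., ρ is nonnegative, symmetric, vanishes on the diagonal, and satisfies the triangle inequality) such that for all t, t₁, t₂ ≥ 0 and all x, x₁, x₂ ∈ X: ρ((x₁,t),(x₂,t)) = t·d(x₁,x₂), ρ((x₁,t₁),(x₂,t₂)) ≥ |t₁ − t₂|, and ρ((x,t₁),(x,t₂)) ≤ 10·|t₁ − t₂|. Then for all points p, q ∈ X × [0,∞): ρ(p,q) ≤ 10·d_c(p,q) and d_c(p,q) ≤ 12·ρ(p,q), where d_c((x₁,t₁),(x₂,t₂)) = |t₁ − t₂| + min(t₁,t₂)·d(x₁,x₂). -/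
open Metric

/-- **Lemma (cone metrics).** If `ρ` is a pseudometric on `X × [0,∞)` satisfying
`ρ((x₁,t),(x₂,t)) = t d(x₁,x₂)`, `ρ ≥ |t₁ - t₂|` and `ρ((x,t₁),(x,t₂)) ≤ 10 |t₁ - t₂|`,
then `ρ` is comparable to the cone metric `d_c`. -/
theorem cone_metric_comparison (X : Type*) [MetricSpace X]
    (hX : EMetric.diam (Set.univ : Set X) ≤ 2)
    (ρ : X × ℝ → X × ℝ → ℝ)
    (hnonneg : ∀ p q : X × ℝ, 0 ≤ p.2 → 0 ≤ q.2 → 0 ≤ ρ p q)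
    (hsymm : ∀ p q : X × ℝ, 0 ≤ p.2 → 0 ≤ q.2 → ρ p q = ρ q p)
    (hrefl : ∀ p : X × ℝ, 0 ≤ p.2 → ρ p p = 0)
    (htri : ∀ p q r : X × ℝ, 0 ≤ p.2 → 0 ≤ q.2 → 0 ≤ r.2 → ρ p r ≤ ρ p q + ρ q r)
    (h₁ : ∀ (t : ℝ), 0 ≤ t → ∀ x₁ x₂ : X, ρ (x₁, t) (x₂, t) = t * dist x₁ x₂)
    (h₂ : ∀ (t₁ t₂ : ℝ), 0 ≤ t₁ → 0 ≤ t₂ → ∀ x₁ x₂ : X, |t₁ - t₂| ≤ ρ (x₁, t₁) (x₂, t₂))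
    (h₃ : ∀ (t₁ t₂ : ℝ), 0 ≤ t₁ → 0 ≤ t₂ → ∀ x : X, ρ (x, t₁) (x, t₂) ≤ 10 * |t₁ - t₂|) :
    ∀ p q : X × ℝ, 0 ≤ p.2 → 0 ≤ q.2 →
      ρ p q ≤ 10 * (|p.2 - q.2| + min p.2 q.2 * dist p.1 q.1) ∧
      |p.2 - q.2| + min p.2 q.2 * dist p.1 q.1 ≤ 12 * ρ p q := by
  have key : ∀ (x y : X) (s t : ℝ), 0 ≤ s → 0 ≤ t →
      ρ (x, s) (y, t) ≤ 10 * (|s - t| + s * dist x y) ∧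
      |s - t| + s * dist x y ≤ 12 * ρ (x, s) (y, t) := by
    intro x y s t hs ht
    have a := htri (x, s) (y, s) (y, t) hs hs ht
    have b := htri (x, s) (y, t) (y, s) hs ht hs
    have c := h₃ s t hs ht y
    have d := hsymm (y, s) (y, t) hs ht
    have e := h₁ s hs x y
    have f := h₂ s t hs ht x y
    have g : 0 ≤ s * dist x y := mul_nonneg hs dist_nonneg
    constructor <;> linarith
  rintro ⟨x, s⟩ ⟨y, t⟩ hs ht
  rcases le_total s t with h | h
  · simpa only [min_eq_left h] using key x y s t hs ht
  · have k := key y x t s ht hs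
    rw [hsymm (y, t) (x, s) ht hs, abs_sub_comm, dist_comm] at k
    simpa only [min_eq_right h] using k
end

section
/- Let (X,d) be a metric space with diam X ≤ 2 that admits a bi-Lipschitz embedding into ℝ^m. Then the cone over X admits a bi-Lipschitz embedding into ℝ^(m+1): there exist a constant L ≥ 1 and a map g : X × [0,∞) → ℝ^(m+1) such that L⁻¹·d_c(p,q) ≤ ‖g(p) − g(q)‖ ≤ L·d_c(p,q) for all p, q ∈ X × [0,∞), where d_c((x₁,t₁),(x₂,t₂)) = |t₁ − t₂| + min(t₁,t₂)·d(x₁,x₂). -/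
open Metric

lemma cone_aux {m : ℕ} (L d s t : ℝ) (a b : EuclideanSpace ℝ (Fin m))
    (u v : EuclideanSpace ℝ (Fin (m + 1))) (hL : 1 ≤ L) (hs : 0 ≤ s) (hst : s ≤ t)
    (hd : 0 ≤ d) (hu : u = WithLp.toLp 2 (Fin.cons s (s • a).ofLp))
    (hv : v = WithLp.toLp 2 (Fin.cons t (t • b).ofLp))
    (h1 : L⁻¹ * d ≤ ‖a - b‖) (h2 : ‖a - b‖ ≤ L * d) (hb : ‖b‖ ≤ 2 * L) :
    (1 + 2 * L + 2 * L ^ 2)⁻¹ * ((t - s) + s * d) ≤ ‖u - v‖ ∧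
      ‖u - v‖ ≤ (1 + 2 * L + 2 * L ^ 2) * ((t - s) + s * d) := by
  have hN : ‖u - v‖ ^ 2 = (t - s) ^ 2 + ‖s • a - t • b‖ ^ 2 := by
    subst hu hv
    rw [EuclideanSpace.norm_sq_eq, EuclideanSpace.norm_sq_eq, Fin.sum_univ_succ]
    simp
    ring
  have key : s • a - t • b = s • (a - b) - (t - s) • b := by
    rw [smul_sub, sub_smul]; abel
  have e1 : ‖s • (a - b)‖ = s * ‖a - b‖ := by rw [norm_smul, Real.norm_of_nonneg hs]
  have e2 : ‖(t - s) • b‖ = (t - s) * ‖b‖ := by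
    rw [norm_smul, Real.norm_of_nonneg (sub_nonneg.2 hst)]
  have up : ‖s • a - t • b‖ ≤ s * ‖a - b‖ + (t - s) * ‖b‖ := by
    rw [key, ← e1, ← e2]; exact norm_sub_le _ _
  have lo : s * ‖a - b‖ - (t - s) * ‖b‖ ≤ ‖s • a - t • b‖ := by
    rw [key, ← e1, ← e2]; exact norm_sub_norm_le _ _
  have hts : 0 ≤ t - s := sub_nonneg.2 hst
  have hL0 : 0 < L := by linarith
  have h1' : d ≤ L * ‖a - b‖ := by
    rwa [inv_mul_le_iff₀ hL0] at h1
  set N := ‖u - v‖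
  set M := ‖s • a - t • b‖
  have N0 : 0 ≤ N := norm_nonneg _
  have M0 : 0 ≤ M := norm_nonneg _
  have hb2 : (t - s) * ‖b‖ ≤ (t - s) * (2 * L) := mul_le_mul_of_nonneg_left hb hts
  have n1 : t - s ≤ N := abs_le_of_sq_le_sq' (by nlinarith) N0 |>.2
  have n2 : M ≤ N := abs_le_of_sq_le_sq' (by nlinarith) N0 |>.2
  have n3 : N ≤ (t - s) + M := abs_le_of_sq_le_sq' (by nlinarith) (by linarith) |>.2
  have hsd : 0 ≤ s * d := mul_nonneg hs hd
  have hK : 0 < 1 + 2 * L + 2 * L ^ 2 := by positivity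
  constructor
  · rw [inv_mul_le_iff₀ hK]
    have g1 : s * d ≤ L * (s * ‖a - b‖) := by
      have := mul_le_mul_of_nonneg_left h1' hs
      linarith
    have g2 : s * ‖a - b‖ ≤ N + N * (2 * L) := by
      have := mul_le_mul_of_nonneg_right n1 (by positivity : 0 ≤ 2 * L)
      linarith
    have g3 := mul_le_mul_of_nonneg_left g2 hL0.le
    have g4 : 0 ≤ L * N := by positivity
    nlinarith
  · have g1 : s * ‖a - b‖ ≤ s * (L * d) := mul_le_mul_of_nonneg_left h2 hs
    have g2 : 0 ≤ L ^ 2 * (t - s) := by positivity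
    have g3 : 0 ≤ L ^ 2 * (s * d) := by positivity
    have g4 : 0 ≤ L * (s * d) := by positivity
    nlinarith

/-- **Corollary (cone embedding).** If a metric space `X` of diameter at most 2 admits a
bi-Lipschitz embedding into `ℝ^m`, then the cone over `X` (with the cone metric `d_c`)
admits a bi-Lipschitz embedding into `ℝ^(m+1)`. -/
theorem cone_biLipschitz_embedding (X : Type*) [MetricSpace X]
    (hX : EMetric.diam (Set.univ : Set X) ≤ 2) (m : ℕ)
    (hembed : ∃ (L : ℝ) (f : X → EuclideanSpace ℝ (Fin m)), 1 ≤ L ∧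
      ∀ x y : X, L⁻¹ * dist x y ≤ ‖f x - f y‖ ∧ ‖f x - f y‖ ≤ L * dist x y) :
    ∃ (L : ℝ) (g : X × ℝ → EuclideanSpace ℝ (Fin (m + 1))), 1 ≤ L ∧
      ∀ (x₁ x₂ : X) (t₁ t₂ : ℝ), 0 ≤ t₁ → 0 ≤ t₂ →
        L⁻¹ * (|t₁ - t₂| + min t₁ t₂ * dist x₁ x₂) ≤ ‖g (x₁, t₁) - g (x₂, t₂)‖ ∧
        ‖g (x₁, t₁) - g (x₂, t₂)‖ ≤ L * (|t₁ - t₂| + min t₁ t₂ * dist x₁ x₂) := by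
  obtain ⟨L, f, hL, hf⟩ := hembed
  rcases isEmpty_or_nonempty X with hE | ⟨⟨x0⟩⟩
  · exact ⟨1, fun _ => 0, le_refl _, fun x => (hE.false x).elim⟩
  have hd : ∀ x y : X, dist x y ≤ 2 := by
    intro x y
    have h : edist x y ≤ 2 :=
      (Metric.edist_le_ediam_of_mem (Set.mem_univ x) (Set.mem_univ y)).trans hX
    rw [edist_dist] at h
    have h' := ENNReal.toReal_mono (by simp) h
    rwa [ENNReal.toReal_ofReal dist_nonneg, ENNReal.toReal_ofNat] at h'
  have hb : ∀ x, ‖f x - f x0‖ ≤ 2 * L := by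
    intro x
    have := (hf x x0).2
    have := mul_le_mul_of_nonneg_left (hd x x0) (by linarith : 0 ≤ L)
    linarith
  refine ⟨1 + 2 * L + 2 * L ^ 2,
    fun p => WithLp.toLp 2 (Fin.cons p.2 (p.2 • (f p.1 - f x0)).ofLp), by nlinarith, ?_⟩
  intro x y s t hs ht
  rcases le_total s t with h | h
  · rw [min_eq_left h, abs_sub_comm, abs_of_nonneg (sub_nonneg.2 h)]
    exact cone_aux L (dist x y) s t (f x - f x0) (f y - f x0) _ _ hL hs h dist_nonneg rfl rfl
      (by simpa using (hf x y).1) (by simpa using (hf x y).2) (hb y)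
  · rw [min_eq_right h, abs_of_nonneg (sub_nonneg.2 h), norm_sub_rev, dist_comm]
    exact cone_aux L (dist y x) t s (f y - f x0) (f x - f x0) _ _ hL ht h dist_nonneg rfl rfl
      (by simpa using (hf y x).1) (by simpa using (hf y x).2) (hb x)
end

section
/- Fix n ≥ 1 and let Z = {B ∈ ℝ^(n) : min B = 0}. The map f : ℝ^(n) → ℝ × Z defined by f(A) = (min A, A − min A), where A − min A = {a − min A : a ∈ A}, is a lipeomorphism: there exists L ≥ 1 such that L⁻¹·d_H(A,B) ≤ d((min A, A − min A), (min B, B − min B)) ≤ L·d_H(A,B) for all A, B ∈ ℝ^(n), where ℝ × Z carries the Euclidean product metric d((a,A'),(b,B'))² = |a − b|² + d_H(A',B')², and f is a bijection from ℝ^(n) onto ℝ × Z. -/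
open Metric

theorem aux_near {A B : Set ℝ} (hA : A.Finite) (hA' : A.Nonempty) (hB : B.Finite)
    (hB' : B.Nonempty) : ∀ x ∈ A, ∃ y ∈ B, |x - y| ≤ hausdorffDist A B := by
  intro x hx
  obtain ⟨y, hy, h⟩ := hB.isCompact.exists_infDist_eq_dist hB' x
  refine ⟨y, hy, ?_⟩
  rw [← Real.dist_eq, ← h]
  exact infDist_le_hausdorffDist_of_mem hx
    (hausdorffEDist_ne_top_of_nonempty_of_bounded hA' hB' hA.isBounded hB.isBounded)

theorem aux_shift {A B : Set ℝ} (hA : A.Finite) (hA' : A.Nonempty) (hB : B.Finite)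
    (hB' : B.Nonempty) (s t : ℝ) :
    hausdorffDist ((fun x => x - s) '' A) ((fun x => x - t) '' B)
      ≤ hausdorffDist A B + |s - t| := by
  have key : ∀ x y : ℝ, |(x - s) - (y - t)| ≤ |x - y| + |s - t| := by
    intro x y
    have : (x - s) - (y - t) = (x - y) - (s - t) := by ring
    rw [this]
    exact abs_sub _ _
  apply hausdorffDist_le_of_mem_dist
  · have := hausdorffDist_nonneg (s := A) (t := B)
    positivity
  · rintro _ ⟨x, hx, rfl⟩
    obtain ⟨y, hy, h⟩ := aux_near hA hA' hB hB' x hx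
    refine ⟨_, ⟨y, hy, rfl⟩, ?_⟩
    rw [Real.dist_eq]
    have := key x y
    linarith
  · rintro _ ⟨y, hy, rfl⟩
    obtain ⟨x, hx, h⟩ := aux_near hB hB' hA hA' y hy
    refine ⟨_, ⟨x, hx, rfl⟩, ?_⟩
    rw [dist_comm, Real.dist_eq]
    have := key x y
    rw [abs_sub_comm, hausdorffDist_comm] at h
    linarith

theorem aux_inf {A B : Set ℝ} (hA : A.Finite) (hA' : A.Nonempty) (hB : B.Finite)
    (hB' : B.Nonempty) : sInf A - sInf B ≤ hausdorffDist A B := by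
  obtain ⟨x, hx, h⟩ := aux_near hB hB' hA hA' (sInf B) (hB'.csInf_mem hB)
  have h1 := csInf_le hA.bddBelow hx
  have h2 := neg_abs_le (sInf B - x)
  rw [hausdorffDist_comm] at h
  linarith

theorem aux_image (A : Set ℝ) (s : ℝ) :
    (fun x => x - -s) '' ((fun x => x - s) '' A) = A := by
  rw [Set.image_image]
  simp

/-- **Lemma (Kovalev, part of Lemma 2.6).** The map `A ↦ (min A, A - min A)` is a
lipeomorphism from `ℝ^(n)` onto `ℝ × Z`, where `Z = {B ∈ ℝ^(n) : min B = 0}` and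
`ℝ × Z` carries the Euclidean product metric. -/
theorem symmetric_product_splits_off_line (n : ℕ) (hn : 1 ≤ n) :
    ∃ L : ℝ, 1 ≤ L ∧
      (∀ A B : {A : Set ℝ // A.Finite ∧ A.Nonempty ∧ A.ncard ≤ n},
        L⁻¹ * hausdorffDist A.1 B.1 ≤
          Real.sqrt (|sInf A.1 - sInf B.1| ^ 2 +
            hausdorffDist ((fun x => x - sInf A.1) '' A.1) ((fun x => x - sInf B.1) '' B.1) ^ 2) ∧
        Real.sqrt (|sInf A.1 - sInf B.1| ^ 2 +
            hausdorffDist ((fun x => x - sInf A.1) '' A.1) ((fun x => x - sInf B.1) '' B.1) ^ 2) ≤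
          L * hausdorffDist A.1 B.1) ∧
      Function.Injective (fun A : {A : Set ℝ // A.Finite ∧ A.Nonempty ∧ A.ncard ≤ n} =>
        ((sInf A.1, (fun x => x - sInf A.1) '' A.1) : ℝ × Set ℝ)) ∧
      (∀ (b : ℝ) (B : Set ℝ), B.Finite → B.Nonempty → B.ncard ≤ n → sInf B = 0 →
        ∃ A : {A : Set ℝ // A.Finite ∧ A.Nonempty ∧ A.ncard ≤ n},
          sInf A.1 = b ∧ (fun x => x - sInf A.1) '' A.1 = B) := by
  refine ⟨3, by norm_num, ?_, ?_, ?_⟩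
  · rintro ⟨A, hA, hA', -⟩ ⟨B, hB, hB', -⟩
    dsimp only
    have h1 := aux_inf hA hA' hB hB'
    have h2 := aux_inf hB hB' hA hA'
    rw [hausdorffDist_comm] at h2
    have h3 := aux_shift hA hA' hB hB' (sInf A) (sInf B)
    have h4 := aux_shift (hA.image (fun x => x - sInf A)) (hA'.image _)
      (hB.image (fun x => x - sInf B)) (hB'.image _) (-sInf A) (-sInf B)
    rw [aux_image, aux_image] at h4
    have e : |-sInf A - -sInf B| = |sInf A - sInf B| := by
      rw [abs_sub_comm]; congr 1; ring
    rw [e] at h4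
    have h5 : |sInf A - sInf B| ≤ hausdorffDist A B := abs_le.2 ⟨by linarith, h1⟩
    have hk := hausdorffDist_nonneg (s := (fun x => x - sInf A) '' A)
      (t := (fun x => x - sInf B) '' B)
    have hm := abs_nonneg (sInf A - sInf B)
    generalize |sInf A - sInf B| = m at *
    generalize hausdorffDist ((fun x => x - sInf A) '' A) ((fun x => x - sInf B) '' B) = k at *
    generalize hausdorffDist A B = h at *
    constructor
    · apply Real.le_sqrt_of_sq_le
      have : 3⁻¹ * h ≤ 3⁻¹ * (k + m) := by linarith
      have h0 : 0 ≤ 3⁻¹ * h := by linarith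
      nlinarith [sq_nonneg (k - m)]
    · rw [Real.sqrt_le_left (by linarith)]
      nlinarith
  · rintro ⟨A, hA⟩ ⟨B, hB⟩ h
    simp only [Prod.mk.injEq] at h
    apply Subtype.ext
    dsimp only
    rw [← aux_image A (sInf A), h.2, h.1, aux_image]
  · intro b B hB hB' hc h0
    have hinf : sInf ((fun x => x - -b) '' B) = b := by
      apply IsLeast.csInf_eq
      constructor
      · exact ⟨0, h0 ▸ hB'.csInf_mem hB, by simp⟩
      · rintro _ ⟨x, hx, rfl⟩
        have := csInf_le hB.bddBelow hx
        dsimp only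
        linarith
    refine ⟨⟨(fun x => x - -b) '' B, hB.image _, hB'.image _,
      (Set.ncard_image_le hB).trans hc⟩, hinf, ?_⟩
    dsimp only
    rw [hinf, Set.image_image]
    simp
end

section
/- Fix n ≥ 2 and let 𝕀_*^(n) = {A ⊆ [0,1] : 0 ∈ A, 1 ∈ A, and A has cardinality at most n}, equipped with the Hausdorff metric. If 𝕀_*^(n) admits a bi-Lipschitz embedding into ℝ^m, then the symmetric product ℝ^(n) admits a bi-Lipschitz embedding into ℝ^(m+2). -/
open Metric

lemma aux_le {A B : Set ℝ} (hB : B.Finite) (hA : A.Finite) (hAn : A.Nonempty) (hBn : B.Nonempty) :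
    ∀ x ∈ A, ∃ y ∈ B, |x - y| ≤ hausdorffDist A B := by
  intro x hx
  obtain ⟨y, hy, he⟩ := hB.isCompact.exists_infDist_eq_dist hBn x
  refine ⟨y, hy, ?_⟩
  rw [← Real.dist_eq, ← he]
  exact infDist_le_hausdorffDist_of_mem hx
    (hausdorffEDist_ne_top_of_nonempty_of_bounded hAn hBn hA.isBounded hB.isBounded)

lemma aux_norm (n : ℕ) (hn : 2 ≤ n) (A : Set ℝ) (hA : A.Finite) (hne : A.Nonempty)
    (hc : A.ncard ≤ n) : ∃ (a d : ℝ)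
    (T : {A : Set ℝ // A ⊆ Set.Icc 0 1 ∧ (0 : ℝ) ∈ A ∧ (1 : ℝ) ∈ A ∧ A.Finite ∧ A.ncard ≤ n}),
    0 ≤ d ∧ A = (fun x => a + d * x) '' T.1 := by
  obtain ⟨a, ha, hmin⟩ := Set.exists_min_image A id hA hne
  obtain ⟨b, hb, hmax⟩ := Set.exists_max_image A id hA hne
  simp only [id] at hmin hmax
  rcases (hmin b hb).eq_or_lt with h | h
  · refine ⟨a, 0, ⟨{0, 1}, ?_, by simp, by simp, by simp, ?_⟩, le_rfl, ?_⟩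
    · intro x hx
      rcases hx with rfl | rfl <;> simp
    · exact (Set.ncard_pair (by norm_num : (0 : ℝ) ≠ 1)).le.trans hn
    · ext x
      constructor
      · intro hx
        exact ⟨0, by simp, by have := hmin x hx; have := hmax x hx; simp; linarith⟩
      · rintro ⟨y, -, rfl⟩
        simpa using ha
  · have hd : 0 < b - a := by linarith
    refine ⟨a, b - a, ⟨(fun x => (x - a) / (b - a)) '' A, ?_, ⟨a, ha, by simp⟩,
      ⟨b, hb, div_self hd.ne'⟩, hA.image _, (Set.ncard_image_le hA).trans hc⟩, hd.le, ?_⟩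
    · rintro _ ⟨x, hx, rfl⟩
      have := hmin x hx
      have := hmax x hx
      exact ⟨div_nonneg (by linarith) hd.le, (div_le_one hd).2 (by linarith)⟩
    · ext x
      simp only [Set.image_image]
      have : ∀ y : ℝ, a + (b - a) * ((y - a) / (b - a)) = y := by
        intro y; field_simp; ring
      simp [this]

/-- Geometry of the normalisation. -/
lemma aux_geom {S T : Set ℝ} {a b d e : ℝ} (hd : 0 ≤ d) (he : 0 ≤ e)
    (hS : S ⊆ Set.Icc 0 1) (hT : T ⊆ Set.Icc 0 1) (hS0 : (0 : ℝ) ∈ S) (hS1 : (1 : ℝ) ∈ S)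
    (hT0 : (0 : ℝ) ∈ T) (hT1 : (1 : ℝ) ∈ T) (hSf : S.Finite) (hTf : T.Finite) {h : ℝ}
    (hh : h = hausdorffDist ((fun x => a + d * x) '' S) ((fun x => b + e * x) '' T)) :
    |a - b| ≤ h ∧ |d - e| ≤ 2 * h ∧ e * hausdorffDist S T ≤ 4 * h ∧
    h ≤ |a - b| + |d - e| + e * hausdorffDist S T := by
  have hSn : S.Nonempty := ⟨0, hS0⟩
  have hTn : T.Nonempty := ⟨0, hT0⟩
  have k1 := aux_le (hTf.image (fun x => b + e * x)) (hSf.image (fun x => a + d * x))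
    (hSn.image _) (hTn.image _)
  have k2 := aux_le (hSf.image (fun x => a + d * x)) (hTf.image (fun x => b + e * x))
    (hTn.image _) (hSn.image _)
  rw [hausdorffDist_comm] at k2
  rw [← hh] at k1 k2
  have h0 : 0 ≤ h := hh ▸ hausdorffDist_nonneg
  replace k1 : ∀ x ∈ S, ∃ y ∈ T, |(a + d * x) - (b + e * y)| ≤ h := by
    intro x hx
    obtain ⟨_, ⟨y, hy, rfl⟩, hxy⟩ := k1 _ ⟨x, hx, rfl⟩
    exact ⟨y, hy, hxy⟩
  replace k2 : ∀ y ∈ T, ∃ x ∈ S, |(a + d * x) - (b + e * y)| ≤ h := by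
    intro y hy
    obtain ⟨_, ⟨x, hx, rfl⟩, hxy⟩ := k2 _ ⟨y, hy, rfl⟩
    exact ⟨x, hx, by rw [abs_sub_comm]; exact hxy⟩
  have m1 := aux_le hTf hSf hSn hTn
  have m2 := aux_le hSf hTf hTn hSn
  rw [hausdorffDist_comm] at m2
  have hab : |a - b| ≤ h := by
    obtain ⟨y, hy, h1⟩ := k1 0 hS0
    obtain ⟨x, hx, h2⟩ := k2 0 hT0
    rw [abs_le] at *
    have := mul_nonneg hd (hS hx).1
    have := mul_nonneg he (hT hy).1
    constructor <;> linarith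
  have hmx : |(a + d) - (b + e)| ≤ h := by
    obtain ⟨y, hy, h1⟩ := k1 1 hS1
    obtain ⟨x, hx, h2⟩ := k2 1 hT1
    rw [abs_le] at *
    have := mul_le_mul_of_nonneg_left (hS hx).2 hd
    have := mul_le_mul_of_nonneg_left (hT hy).2 he
    constructor <;> linarith
  have hde : |d - e| ≤ 2 * h := by
    rw [abs_le] at *
    constructor <;> linarith
  have hx1 : ∀ x ∈ S, |(d - e) * x| ≤ |d - e| := by
    intro x hx
    rw [abs_mul, abs_of_nonneg (hS hx).1]
    exact mul_le_of_le_one_right (abs_nonneg _) (hS hx).2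
  refine ⟨hab, hde, ?_, ?_⟩
  · have key : ∀ x ∈ S, ∀ y ∈ T, |(a + d * x) - (b + e * y)| ≤ h → e * |x - y| ≤ 4 * h := by
      intro x hx y hy hxy
      have := hx1 x hx
      have h3 : e * |x - y| = |e * x - e * y| := by
        rw [← mul_sub, abs_mul, abs_of_nonneg he]
      rw [h3]
      have h4 := this.trans hde
      rw [abs_le] at *
      constructor <;> linarith
    rcases he.eq_or_lt with rfl | he
    · simpa using h0
    · rw [mul_comm, ← le_div_iff₀ he]
      refine hausdorffDist_le_of_mem_dist (by positivity) ?_ ?_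
      · intro x hx
        obtain ⟨y, hy, h1⟩ := k1 x hx
        refine ⟨y, hy, ?_⟩
        rw [le_div_iff₀ he, mul_comm, Real.dist_eq]
        exact key x hx y hy h1
      · intro y hy
        obtain ⟨x, hx, h1⟩ := k2 y hy
        refine ⟨x, hx, ?_⟩
        rw [le_div_iff₀ he, mul_comm, Real.dist_eq, abs_sub_comm]
        exact key x hx y hy h1
  · have key : ∀ x ∈ S, ∀ y ∈ T, |x - y| ≤ hausdorffDist S T →
        |(a + d * x) - (b + e * y)| ≤ |a - b| + |d - e| + e * hausdorffDist S T := by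
      intro x hx y hy hxy
      have h1 := hx1 x hx
      have h3 : |e * (x - y)| ≤ e * hausdorffDist S T := by
        rw [abs_mul, abs_of_nonneg he]
        exact mul_le_mul_of_nonneg_left hxy he
      have : (a + d * x) - (b + e * y) = (a - b) + (d - e) * x + e * (x - y) := by ring
      rw [this]
      have := abs_add_three (a - b) ((d - e) * x) (e * (x - y))
      linarith
    rw [hh]
    refine hausdorffDist_le_of_mem_dist
      (add_nonneg (by positivity) (mul_nonneg he hausdorffDist_nonneg)) ?_ ?_
    · rintro _ ⟨x, hx, rfl⟩
      obtain ⟨y, hy, h1⟩ := m1 x hx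
      exact ⟨_, ⟨y, hy, rfl⟩, key x hx y hy h1⟩
    · rintro _ ⟨y, hy, rfl⟩
      obtain ⟨x, hx, h1⟩ := m2 y hy
      refine ⟨_, ⟨x, hx, rfl⟩, ?_⟩
      rw [dist_comm]
      exact key x hx y hy (by rw [abs_sub_comm]; exact h1)

/-- Append two coordinates. -/
noncomputable def auxCons {m : ℕ} (a d : ℝ) (v : EuclideanSpace ℝ (Fin m)) :
    EuclideanSpace ℝ (Fin (m + 2)) :=
  WithLp.toLp 2 (Fin.cons a (Fin.cons d (fun i => v i) : Fin (m + 1) → ℝ) : Fin (m + 1 + 1) → ℝ)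

lemma auxCons_norm {m : ℕ} (a d b e : ℝ) (v w : EuclideanSpace ℝ (Fin m)) :
    ‖auxCons a d v - auxCons b e w‖ ^ 2 = |a - b| ^ 2 + |d - e| ^ 2 + ‖v - w‖ ^ 2 := by
  rw [EuclideanSpace.norm_sq_eq, EuclideanSpace.norm_sq_eq, Fin.sum_univ_succ, Fin.sum_univ_succ]
  simp [auxCons, add_assoc]

/-- **Corollary (Kovalev).** If the higher-dimensional dunce hat `𝕀_*^(n)` (subsets of
`[0,1]` of cardinality at most `n` containing `0` and `1`, with the Hausdorff metric)
admits a bi-Lipschitz embedding into `ℝ^m`, then `ℝ^(n)` admits a bi-Lipschitz embedding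
into `ℝ^(m+2)`. -/
theorem dunce_hat_embedding_gives_symmetric_product_embedding (n m : ℕ) (hn : 2 ≤ n)
    (hembed : ∃ (L : ℝ)
        (f : {A : Set ℝ // A ⊆ Set.Icc 0 1 ∧ (0 : ℝ) ∈ A ∧ (1 : ℝ) ∈ A ∧ A.Finite ∧ A.ncard ≤ n} →
          EuclideanSpace ℝ (Fin m)), 1 ≤ L ∧
        ∀ A B : {A : Set ℝ // A ⊆ Set.Icc 0 1 ∧ (0 : ℝ) ∈ A ∧ (1 : ℝ) ∈ A ∧ A.Finite ∧ A.ncard ≤ n},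
          L⁻¹ * hausdorffDist A.1 B.1 ≤ ‖f A - f B‖ ∧ ‖f A - f B‖ ≤ L * hausdorffDist A.1 B.1) :
    ∃ (L : ℝ) (g : {A : Set ℝ // A.Finite ∧ A.Nonempty ∧ A.ncard ≤ n} →
        EuclideanSpace ℝ (Fin (m + 2))), 1 ≤ L ∧
      ∀ A B : {A : Set ℝ // A.Finite ∧ A.Nonempty ∧ A.ncard ≤ n},
        L⁻¹ * hausdorffDist A.1 B.1 ≤ ‖g A - g B‖ ∧
        ‖g A - g B‖ ≤ L * hausdorffDist A.1 B.1 := by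
  obtain ⟨L, f, hL, hf⟩ := hembed
  have H := fun A : {A : Set ℝ // A.Finite ∧ A.Nonempty ∧ A.ncard ≤ n} =>
    aux_norm n hn A.1 A.2.1 A.2.2.1 A.2.2.2
  choose a d T hd hT using H
  have hA0 : ({0, 1} : Set ℝ) ⊆ Set.Icc 0 1 := by
    intro x hx
    rcases hx with rfl | rfl <;> simp
  let A0 : {A : Set ℝ // A ⊆ Set.Icc 0 1 ∧ (0 : ℝ) ∈ A ∧ (1 : ℝ) ∈ A ∧ A.Finite ∧ A.ncard ≤ n} :=
    ⟨{0, 1}, hA0, by simp, by simp, by simp,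
      (Set.ncard_pair (by norm_num : (0 : ℝ) ≠ 1)).le.trans hn⟩
  have hbd : ∀ S, ‖f S - f A0‖ ≤ L := by
    intro S
    have h1 : hausdorffDist S.1 A0.1 ≤ 1 := by
      refine hausdorffDist_le_of_mem_dist zero_le_one ?_ ?_
      · intro x hx
        exact ⟨0, A0.2.2.1, Real.dist_le_of_mem_Icc_01 (S.2.1 hx) (by simp)⟩
      · intro x hx
        exact ⟨0, S.2.2.1, Real.dist_le_of_mem_Icc_01 (A0.2.1 hx) (by simp)⟩
    calc _ ≤ L * hausdorffDist S.1 A0.1 := (hf S A0).2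
      _ ≤ L * 1 := by gcongr
      _ = L := mul_one L
  refine ⟨9 * L ^ 2, fun A => auxCons (a A) (d A) (d A • (f (T A) - f A0)), by nlinarith, ?_⟩
  intro A B
  obtain ⟨g1, g2, g3, g4⟩ := aux_geom (a := a A) (b := a B) (hd A) (hd B) (T A).2.1 (T B).2.1
    (T A).2.2.1 (T A).2.2.2.1 (T B).2.2.1 (T B).2.2.2.1 (T A).2.2.2.2.1 (T B).2.2.2.2.1 rfl
  rw [← hT A, ← hT B] at g1 g2 g3 g4
  obtain ⟨f1, f2⟩ := hf (T A) (T B)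
  have hG := auxCons_norm (a A) (d A) (a B) (d B) (d A • (f (T A) - f A0)) (d B • (f (T B) - f A0))
  set G := ‖auxCons (a A) (d A) (d A • (f (T A) - f A0)) -
    auxCons (a B) (d B) (d B • (f (T B) - f A0))‖
  have hG0 : 0 ≤ G := norm_nonneg _
  have hEq : d A • (f (T A) - f A0) - d B • (f (T B) - f A0)
    = d B • (f (T A) - f (T B)) + (d A - d B) • (f (T A) - f A0) := by module
  have e1 : ‖(d A - d B) • (f (T A) - f A0)‖ ≤ |d A - d B| * L := by
    rw [norm_smul, Real.norm_eq_abs]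
    exact mul_le_mul_of_nonneg_left (hbd _) (abs_nonneg _)
  have e2 : ‖d B • (f (T A) - f (T B))‖ = d B * ‖f (T A) - f (T B)‖ := by
    rw [norm_smul, Real.norm_eq_abs, abs_of_nonneg (hd B)]
  have n1 := norm_add_le (d B • (f (T A) - f (T B))) ((d A - d B) • (f (T A) - f A0))
  have n2 := norm_sub_le (d B • (f (T A) - f (T B)) + (d A - d B) • (f (T A) - f A0))
    ((d A - d B) • (f (T A) - f A0))
  rw [add_sub_cancel_right, e2] at n2
  rw [e2] at n1
  rw [← hEq] at n1 n2
  set N := ‖d A • (f (T A) - f A0) - d B • (f (T B) - f A0)‖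
  have hN0 : 0 ≤ N := norm_nonneg _
  set M := ‖f (T A) - f (T B)‖
  set h := hausdorffDist A.1 B.1
  set t := hausdorffDist (T A).1 (T B).1
  set p := |a A - a B|
  set q := |d A - d B|
  have hp0 : 0 ≤ p := abs_nonneg _
  have hq0 : 0 ≤ q := abs_nonneg _
  have hh0 : 0 ≤ h := hp0.trans g1
  have hL0 : 0 < L := by linarith
  have hLL : L ≤ L ^ 2 := by nlinarith
  constructor
  · rw [inv_mul_le_iff₀ (by positivity)]
    have hpG : p ≤ G := abs_le_of_sq_le_sq' (by nlinarith) hG0 |>.2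
    have hqG : q ≤ G := abs_le_of_sq_le_sq' (by nlinarith) hG0 |>.2
    have hNG : N ≤ G := abs_le_of_sq_le_sq' (by nlinarith) hG0 |>.2
    rw [inv_mul_le_iff₀ hL0] at f1
    have s1 : d B * t ≤ L * (d B * M) := by
      have := mul_le_mul_of_nonneg_left f1 (hd B)
      linarith
    have s2 : d B * M ≤ G + G * L := by
      have := mul_le_mul_of_nonneg_right hqG hL0.le
      linarith
    have s3 := mul_le_mul_of_nonneg_left s2 hL0.le
    have s4 : h ≤ (2 + L + L ^ 2) * G := by nlinarith
    have s5 : (2 + L + L ^ 2) * G ≤ 9 * L ^ 2 * G :=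
      mul_le_mul_of_nonneg_right (by nlinarith) hG0
    linarith
  · have r1 := mul_nonneg hp0 hq0
    have r2 := mul_nonneg hp0 hN0
    have r3 := mul_nonneg hq0 hN0
    have s0 : G ≤ p + q + N :=
      abs_le_of_sq_le_sq' (by nlinarith) (by positivity) |>.2
    have s1 : d B * M ≤ L * (4 * h) := by
      have := mul_le_mul_of_nonneg_left f2 (hd B)
      have := mul_le_mul_of_nonneg_left g3 hL0.le
      linarith
    have s2 := mul_le_mul_of_nonneg_right g2 hL0.le
    have s3 : G ≤ (3 + 6 * L) * h := by linarith
    have s5 : (3 + 6 * L) * h ≤ 9 * L ^ 2 * h :=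
      mul_le_mul_of_nonneg_right (by nlinarith) hh0
    linarith
end

section
/- For every integer n ≥ 2, the space 𝕀_*^(n) admits a bi-Lipschitz embedding into the symmetric product ℂ^(n−1): there exist L ≥ 1 and a map F : 𝕀_*^(n) → ℂ^(n−1) with L⁻¹·d_H(A,B) ≤ d_H(F(A),F(B)) ≤ L·d_H(A,B) for all A, B ∈ 𝕀_*^(n). Such an embedding is given by F(A) = {exp(2πit) : t ∈ A}. -/
open Metric Real

lemma key_near {X : Type*} [PseudoMetricSpace X] {A B : Set X} (hA : A.Finite)
    (hB : B.Finite) (hB0 : B.Nonempty) {x : X} (hx : x ∈ A) :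
    ∃ y ∈ B, dist x y ≤ hausdorffDist A B := by
  obtain ⟨y, hy, h⟩ := hB.isCompact.exists_infDist_eq_dist hB0 x
  refine ⟨y, hy, ?_⟩
  rw [← h]
  exact infDist_le_hausdorffDist_of_mem hx
    (hausdorffEDist_ne_top_of_nonempty_of_bounded ⟨x, hx⟩ hB0 hA.isBounded hB.isBounded)

lemma key_dist (s t : ℝ) :
    dist (Complex.exp (2 * π * Complex.I * s)) (Complex.exp (2 * π * Complex.I * t))
      = 2 * |sin (π * (s - t))| := by
  have h : Complex.exp (2 * π * Complex.I * s) - Complex.exp (2 * π * Complex.I * t)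
      = Complex.exp (Complex.I * ((2 * π * t : ℝ) : ℂ)) *
        (Complex.exp (Complex.I * ((2 * π * (s - t) : ℝ) : ℂ)) - 1) := by
    rw [mul_sub, ← Complex.exp_add, mul_one]
    push_cast
    congr 2 <;> ring
  rw [dist_eq_norm, h, norm_mul, Complex.norm_exp_I_mul_ofReal_sub_one,
    Complex.norm_exp_I_mul_ofReal, one_mul, norm_mul, Real.norm_eq_abs, Real.norm_eq_abs]
  rw [show 2 * π * (s - t) / 2 = π * (s - t) by ring]
  norm_num

lemma key_upper (s t : ℝ) :
    dist (Complex.exp (2 * π * Complex.I * s)) (Complex.exp (2 * π * Complex.I * t))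
      ≤ 2 * π * dist s t := by
  rw [key_dist, Real.dist_eq, mul_assoc, ← abs_of_pos pi_pos, ← abs_mul, abs_of_pos pi_pos]
  have := abs_sin_le_abs (x := π * (s - t))
  linarith

lemma sin_low {x : ℝ} (h0 : 0 ≤ x) (h1 : x ≤ 1) :
    2 * x ≤ sin (π * x) ∨ 2 * (1 - x) ≤ sin (π * x) := by
  have hp := pi_pos
  rcases le_total x (1/2) with h | h
  · left
    have := mul_le_sin (x := π * x) (by positivity) (by nlinarith)
    rwa [← mul_assoc, div_mul_cancel₀ _ hp.ne'] at this
  · right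
    have := mul_le_sin (x := π * (1 - x)) (mul_nonneg hp.le (by linarith)) (by nlinarith)
    rw [← mul_assoc, div_mul_cancel₀ _ hp.ne'] at this
    rwa [show π * (1 - x) = π - π * x by ring, sin_pi_sub] at this

lemma key_lower {B : Set ℝ} (hB0 : (0:ℝ) ∈ B) (hB1 : (1:ℝ) ∈ B) {s t : ℝ}
    (hs : s ∈ Set.Icc (0:ℝ) 1) (ht : t ∈ Set.Icc (0:ℝ) 1) (htB : t ∈ B) :
    ∃ y ∈ B, dist s y ≤
      dist (Complex.exp (2 * π * Complex.I * s)) (Complex.exp (2 * π * Complex.I * t)) := by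
  obtain ⟨hs0, hs1⟩ := hs
  obtain ⟨ht0, ht1⟩ := ht
  rcases le_total t s with h | h
  · have ha := le_abs_self (sin (π * (s - t)))
    rw [key_dist]
    rcases sin_low (x := s - t) (by linarith) (by linarith) with h2 | h2
    · exact ⟨t, htB, by rw [Real.dist_eq, abs_of_nonneg] <;> linarith⟩
    · exact ⟨1, hB1, by rw [Real.dist_eq, abs_of_nonpos] <;> linarith⟩
  · have ha := le_abs_self (sin (π * (t - s)))
    rw [dist_comm (Complex.exp _), key_dist]
    rcases sin_low (x := t - s) (by linarith) (by linarith) with h2 | h2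
    · exact ⟨t, htB, by rw [Real.dist_eq, abs_of_nonpos] <;> linarith⟩
    · exact ⟨0, hB0, by rw [Real.dist_eq, abs_of_nonneg] <;> linarith⟩

/-- **Lemma (Borovikova–Ibragimov–Yousefi).** The map `F(A) = {exp(2πit) : t ∈ A}` is a
bi-Lipschitz embedding of the dunce hat `𝕀_*^(n)` into the symmetric product `ℂ^(n-1)`. -/
theorem dunce_hat_embeds_in_complex_symmetric_product (n : ℕ) (hn : 2 ≤ n) :
    ∃ L : ℝ, 1 ≤ L ∧
      (∀ A : {A : Set ℝ // A ⊆ Set.Icc 0 1 ∧ (0 : ℝ) ∈ A ∧ (1 : ℝ) ∈ A ∧ A.Finite ∧ A.ncard ≤ n},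
        ((fun t : ℝ => Complex.exp (2 * π * Complex.I * t)) '' A.1).Finite ∧
        ((fun t : ℝ => Complex.exp (2 * π * Complex.I * t)) '' A.1).Nonempty ∧
        ((fun t : ℝ => Complex.exp (2 * π * Complex.I * t)) '' A.1).ncard ≤ n - 1) ∧
      ∀ A B : {A : Set ℝ // A ⊆ Set.Icc 0 1 ∧ (0 : ℝ) ∈ A ∧ (1 : ℝ) ∈ A ∧ A.Finite ∧ A.ncard ≤ n},
        L⁻¹ * hausdorffDist A.1 B.1 ≤
          hausdorffDist ((fun t : ℝ => Complex.exp (2 * π * Complex.I * t)) '' A.1)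
            ((fun t : ℝ => Complex.exp (2 * π * Complex.I * t)) '' B.1) ∧
        hausdorffDist ((fun t : ℝ => Complex.exp (2 * π * Complex.I * t)) '' A.1)
            ((fun t : ℝ => Complex.exp (2 * π * Complex.I * t)) '' B.1) ≤
          L * hausdorffDist A.1 B.1 := by
  have hpi := pi_gt_three
  refine ⟨2 * π, by linarith, ?_, ?_⟩
  · rintro ⟨A, hA, h0, h1, hf, hc⟩
    refine ⟨hf.image _, ⟨_, ⟨0, h0, rfl⟩⟩, ?_⟩
    have hsub : (fun t : ℝ => Complex.exp (2 * π * Complex.I * t)) '' A ⊆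
        (fun t : ℝ => Complex.exp (2 * π * Complex.I * t)) '' (A \ {1}) := by
      rintro _ ⟨t, ht, rfl⟩
      by_cases h : t = 1
      · refine ⟨0, ⟨h0, by simp⟩, ?_⟩
        simp [h, Complex.exp_two_pi_mul_I]
      · exact ⟨t, ⟨ht, h⟩, rfl⟩
    have hf' : (A \ {1}).Finite := hf.diff
    have h2 := Set.ncard_le_ncard hsub (hf'.image _)
    have h3 := Set.ncard_image_le (f := fun t : ℝ => Complex.exp (2 * π * Complex.I * t)) hf'
    have h4 := Set.ncard_diff_singleton_add_one h1 hf
    simp only at *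
    omega
  · rintro ⟨A, hA, hA0, hA1, hAf, -⟩ ⟨B, hB, hB0, hB1, hBf, -⟩
    simp only
    set e : ℝ → ℂ := fun t : ℝ => Complex.exp (2 * π * Complex.I * t) with he
    have hAn : (e '' A).Nonempty := ⟨_, ⟨0, hA0, rfl⟩⟩
    have hBn : (e '' B).Nonempty := ⟨_, ⟨0, hB0, rfl⟩⟩
    constructor
    · have h : hausdorffDist A B ≤ hausdorffDist (e '' A) (e '' B) := by
        apply hausdorffDist_le_of_mem_dist hausdorffDist_nonneg
        · intro s hs
          obtain ⟨_, ⟨t, ht, rfl⟩, h⟩ := key_near (hAf.image e) (hBf.image e) hBn ⟨s, hs, rfl⟩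
          obtain ⟨y, hy, h'⟩ := key_lower hB0 hB1 (hA hs) (hB ht) ht
          exact ⟨y, hy, h'.trans h⟩
        · intro s hs
          obtain ⟨_, ⟨t, ht, rfl⟩, h⟩ := key_near (hBf.image e) (hAf.image e) hAn ⟨s, hs, rfl⟩
          obtain ⟨y, hy, h'⟩ := key_lower hA0 hA1 (hB hs) (hA ht) ht
          rw [hausdorffDist_comm] at h
          exact ⟨y, hy, h'.trans h⟩
      refine le_trans ?_ h
      exact mul_le_of_le_one_left hausdorffDist_nonneg (inv_le_one_of_one_le₀ (by linarith))
    · apply hausdorffDist_le_of_mem_dist (mul_nonneg (by linarith) hausdorffDist_nonneg)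
      · rintro _ ⟨s, hs, rfl⟩
        obtain ⟨t, ht, h⟩ := key_near hAf hBf ⟨0, hB0⟩ hs
        exact ⟨e t, ⟨t, ht, rfl⟩, (key_upper s t).trans
          (mul_le_mul_of_nonneg_left h (by linarith))⟩
      · rintro _ ⟨s, hs, rfl⟩
        obtain ⟨t, ht, h⟩ := key_near hBf hAf ⟨0, hA0⟩ hs
        rw [hausdorffDist_comm] at h
        exact ⟨e t, ⟨t, ht, rfl⟩, (key_upper s t).trans
          (mul_le_mul_of_nonneg_left h (by linarith))⟩
end

section
/- For all integers n ≥ 2 and d ≥ 2, there exists a bi-Lipschitz embedding g of the symmetric product (ℝ^d)^(n−1) into the n-fold Cartesian product (ℝ^(d−1))^(n−1) × ⋯ × (ℝ^(d−1))^(n−1) (n factors), where the product carries the Euclidean product metric: there exists L ≥ 1 with L⁻¹·d_H(A,B) ≤ d(g(A),g(B)) ≤ L·d_H(A,B) for all A, B ∈ (ℝ^d)^(n−1). -/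
open Metric

lemma exists_near {E : Type*} [MetricSpace E] {A B : Set E} (hA : A.Finite) (hA' : A.Nonempty)
    (hB : B.Finite) (hB' : B.Nonempty) {x : E} (hx : x ∈ A) :
    ∃ y ∈ B, dist x y ≤ hausdorffDist A B := by
  obtain ⟨y, hy, h⟩ := hB.isCompact.exists_infDist_eq_dist hB' x
  refine ⟨y, hy, ?_⟩
  rw [← h]
  exact infDist_le_hausdorffDist_of_mem hx
    (hausdorffEDist_ne_top_of_nonempty_of_bounded hA' hB' hA.isBounded hB.isBounded)

lemma exists_projections (n d : ℕ) (hd : 2 ≤ d) :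
    ∃ (P : Fin n → EuclideanSpace ℝ (Fin d) →L[ℝ] EuclideanSpace ℝ (Fin (d - 1))) (C : ℝ),
      0 ≤ C ∧ ∀ i j, i ≠ j → ∀ v R, ‖P i v‖ ≤ R → ‖P j v‖ ≤ R → ‖v‖ ≤ C * R := by
  obtain ⟨m, rfl⟩ := Nat.exists_eq_add_of_le' hd
  change ∃ (P : Fin n → EuclideanSpace ℝ (Fin (m+2)) →L[ℝ] EuclideanSpace ℝ (Fin (m+1))) (C : ℝ),
      0 ≤ C ∧ ∀ i j, i ≠ j → ∀ v R, ‖P i v‖ ≤ R → ‖P j v‖ ≤ R → ‖v‖ ≤ C * R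
  let Q : Fin n → EuclideanSpace ℝ (Fin (m+2)) →ₗ[ℝ] EuclideanSpace ℝ (Fin (m+1)) := fun j =>
    { toFun := fun x => WithLp.toLp 2 (fun k => x k.succ + (if k = 0 then (j : ℝ) * x 0 else 0))
      map_add' := by
        intro x y; ext k; by_cases hk : k = 0 <;> simp [hk] <;> ring
      map_smul' := by
        intro c x; ext k; by_cases hk : k = 0 <;> simp [hk] <;> ring }
  have key : ∀ i j, i ≠ j → ∃ C : ℝ, 0 ≤ C ∧ ∀ v R, ‖Q i v‖ ≤ R → ‖Q j v‖ ≤ R → ‖v‖ ≤ C * R := by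
    intro i j hij
    have hinj : LinearMap.ker ((Q i).prod (Q j)) = ⊥ := by
      rw [LinearMap.ker_eq_bot']
      intro v hv
      have h1 : Q i v = 0 := congrArg Prod.fst hv
      have h2 : Q j v = 0 := congrArg Prod.snd hv
      have e1 : ∀ k : Fin (m+1), v k.succ + (if k = 0 then (i : ℝ) * v 0 else 0) = 0 :=
        fun k => congrArg (fun w : EuclideanSpace ℝ (Fin (m+1)) => w k) h1
      have e2 : ∀ k : Fin (m+1), v k.succ + (if k = 0 then (j : ℝ) * v 0 else 0) = 0 :=
        fun k => congrArg (fun w : EuclideanSpace ℝ (Fin (m+1)) => w k) h2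
      have a1 := e1 0
      have a2 := e2 0
      rw [if_pos rfl] at a1 a2
      have hne : ((i : ℕ) : ℝ) - ((j : ℕ) : ℝ) ≠ 0 := by
        rw [sub_ne_zero]
        exact_mod_cast fun h => hij (Fin.ext h)
      have h0 : v 0 = 0 := by
        have : (((i : ℕ) : ℝ) - ((j : ℕ) : ℝ)) * v 0 = 0 := by linarith
        exact (mul_eq_zero.mp this).resolve_left hne
      ext k
      refine Fin.cases ?_ (fun k => ?_) k
      · simpa using h0
      · have := e1 k
        rw [h0] at this
        simpa using this
    obtain ⟨K, -, hK⟩ := LinearMap.exists_antilipschitzWith _ hinj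
    refine ⟨K, K.2, fun v R h1 h2 => ?_⟩
    have := hK.le_mul_dist v 0
    rw [map_zero, dist_zero_right, dist_zero_right] at this
    exact this.trans (mul_le_mul_of_nonneg_left (max_le h1 h2) K.2)
  choose C hC hC' using key
  refine ⟨fun j => (Q j).toContinuousLinearMap,
    ∑ i, ∑ j, if h : i ≠ j then C i j h else 0, ?_, ?_⟩
  · refine Finset.sum_nonneg fun i _ => Finset.sum_nonneg fun j _ => ?_
    split_ifs with h
    · exact hC i j h
    · exact le_rfl
  · intro i j hij v R h1 h2
    have hR : 0 ≤ R := (norm_nonneg _).trans h1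
    refine (hC' i j hij v R h1 h2).trans (mul_le_mul_of_nonneg_right ?_ hR)
    have hnn : ∀ i j, 0 ≤ (if h : i ≠ j then C i j h else 0) := by
      intro i j
      split_ifs with h
      · exact hC i j h
      · exact le_rfl
    calc C i j hij = (if h : i ≠ j then C i j h else 0) := by rw [dif_pos hij]
      _ ≤ ∑ j, (if h : i ≠ j then C i j h else 0) :=
        Finset.single_le_sum (f := fun j => if h : i ≠ j then C i j h else 0)
          (fun j _ => hnn i j) (Finset.mem_univ j)
      _ ≤ _ := Finset.single_le_sum (f := fun i => ∑ j, if h : i ≠ j then C i j h else 0)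
          (fun i _ => Finset.sum_nonneg fun j _ => hnn i j) (Finset.mem_univ i)

lemma one_side {E F : Type*} [NormedAddCommGroup E] [NormedSpace ℝ E] [NormedAddCommGroup F]
    [NormedSpace ℝ F] {n : ℕ} (hn : 2 ≤ n) (P : Fin n → E →L[ℝ] F) (C R : ℝ)
    (hC : ∀ i j, i ≠ j → ∀ v R, ‖P i v‖ ≤ R → ‖P j v‖ ≤ R → ‖v‖ ≤ C * R)
    {A B : Set E} (hA : A.Finite) (hA' : A.Nonempty)
    (hB : B.Finite) (hB' : B.Nonempty) (hBn : B.ncard ≤ n - 1)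
    (hR : ∀ j, hausdorffDist (P j '' A) (P j '' B) ≤ R) (x : E) (hx : x ∈ A) :
    ∃ y ∈ B, dist x y ≤ C * R := by
  have h : ∀ j, ∃ y ∈ B, ‖P j (x - y)‖ ≤ R := by
    intro j
    obtain ⟨_, ⟨y, hy, rfl⟩, h⟩ := exists_near (hA.image (P j)) (hA'.image _) (hB.image (P j))
      (hB'.image _) (Set.mem_image_of_mem (P j) hx)
    refine ⟨y, hy, ?_⟩
    rw [map_sub, ← dist_eq_norm]
    exact h.trans (hR j)
  choose y hy hy' using h
  have hcard : hB.toFinset.card < (Finset.univ : Finset (Fin n)).card := by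
    rw [← Set.ncard_eq_toFinset_card B hB, Finset.card_fin]
    omega
  obtain ⟨i, -, j, -, hij, he⟩ := Finset.exists_ne_map_eq_of_card_lt_of_maps_to hcard
    (f := y) (fun j _ => by simpa using hy j)
  refine ⟨y i, hy i, ?_⟩
  rw [dist_eq_norm]
  exact hC i j hij _ R (hy' i) (by rw [he]; exact hy' j)

/-- **Lemma (discrete tomography).** For `n, d ≥ 2` there is a bi-Lipschitz embedding of
the symmetric product `(ℝ^d)^(n-1)` into the Cartesian product of `n` copies of
`(ℝ^(d-1))^(n-1)`, the latter with the Euclidean product metric. -/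
theorem symmetric_product_tomography_embedding (n d : ℕ) (hn : 2 ≤ n) (hd : 2 ≤ d) :
    ∃ (L : ℝ)
      (g : {A : Set (EuclideanSpace ℝ (Fin d)) // A.Finite ∧ A.Nonempty ∧ A.ncard ≤ n - 1} →
        Fin n →
          {A : Set (EuclideanSpace ℝ (Fin (d - 1))) // A.Finite ∧ A.Nonempty ∧ A.ncard ≤ n - 1}),
      1 ≤ L ∧
      ∀ A B : {A : Set (EuclideanSpace ℝ (Fin d)) // A.Finite ∧ A.Nonempty ∧ A.ncard ≤ n - 1},
        L⁻¹ * hausdorffDist A.1 B.1 ≤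
          Real.sqrt (∑ j : Fin n, hausdorffDist (g A j).1 (g B j).1 ^ 2) ∧
        Real.sqrt (∑ j : Fin n, hausdorffDist (g A j).1 (g B j).1 ^ 2) ≤
          L * hausdorffDist A.1 B.1 := by
  obtain ⟨P, C, hC0, hC⟩ := exists_projections n d hd
  have hK0 : 0 ≤ ∑ j, ‖P j‖ := Finset.sum_nonneg fun j _ => norm_nonneg _
  refine ⟨1 + C + ∑ j, ‖P j‖, fun A j => ⟨P j '' A.1, A.2.1.image _, A.2.2.1.image _,
    (Set.ncard_image_le A.2.1).trans A.2.2.2⟩, by linarith, ?_⟩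
  rintro ⟨A, hA, hA', hAn⟩ ⟨B, hB, hB', hBn⟩
  dsimp only
  have hH : 0 ≤ hausdorffDist A B := hausdorffDist_nonneg
  constructor
  · set R := Real.sqrt (∑ j : Fin n, hausdorffDist (P j '' A) (P j '' B) ^ 2) with hRdef
    have hR0 : 0 ≤ R := Real.sqrt_nonneg _
    have hR : ∀ j, hausdorffDist (P j '' A) (P j '' B) ≤ R := by
      intro j
      apply Real.le_sqrt_of_sq_le
      exact Finset.single_le_sum (f := fun j => hausdorffDist (P j '' A) (P j '' B) ^ 2)
        (fun j _ => sq_nonneg _) (Finset.mem_univ j)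
    have h1 : hausdorffDist A B ≤ C * R := by
      refine hausdorffDist_le_of_mem_dist (mul_nonneg hC0 hR0)
        (one_side hn P C R hC hA hA' hB hB' hBn hR)
        (one_side hn P C R hC hB hB' hA hA' hAn (fun j => ?_))
      rw [hausdorffDist_comm]
      exact hR j
    rw [inv_mul_le_iff₀ (by linarith)]
    nlinarith [mul_nonneg hK0 hR0]
  · have hj : ∀ j, hausdorffDist (P j '' A) (P j '' B) ≤ ‖P j‖ * hausdorffDist A B := by
      intro j
      refine hausdorffDist_le_of_mem_dist (mul_nonneg (norm_nonneg _) hH) ?_ ?_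
      · rintro _ ⟨x, hx, rfl⟩
        obtain ⟨y, hy, h⟩ := exists_near hA hA' hB hB' hx
        exact ⟨_, ⟨y, hy, rfl⟩, ((P j).dist_le_opNorm x y).trans
          (mul_le_mul_of_nonneg_left h (norm_nonneg _))⟩
      · rintro _ ⟨x, hx, rfl⟩
        obtain ⟨y, hy, h⟩ := exists_near hB hB' hA hA' hx
        rw [hausdorffDist_comm] at h
        exact ⟨_, ⟨y, hy, rfl⟩, ((P j).dist_le_opNorm x y).trans
          (mul_le_mul_of_nonneg_left h (norm_nonneg _))⟩
    have h2 : Real.sqrt (∑ j : Fin n, hausdorffDist (P j '' A) (P j '' B) ^ 2) ≤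
        ∑ j : Fin n, hausdorffDist (P j '' A) (P j '' B) := by
      rw [Real.sqrt_le_left (Finset.sum_nonneg fun j _ => hausdorffDist_nonneg)]
      exact Finset.sum_sq_le_sq_sum_of_nonneg fun j _ => hausdorffDist_nonneg
    have h3 := Finset.sum_le_sum fun j (_ : j ∈ Finset.univ) => hj j
    rw [← Finset.sum_mul] at h3
    nlinarith [mul_nonneg hC0 hH]
end

section
/- Let X be a nonempty connected subset of ℝ, and let 1 ≤ k < n be integers. Then there exists a Lipschitz retraction r : X^(n) → X^(k): a map r with r(A) ∈ X^(k) for all A ∈ X^(n), r(A) = A for all A ∈ X^(k), and d_H(r(A), r(B)) ≤ C·d_H(A,B) for some constant C and all A, B ∈ X^(n). -/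
open Metric

namespace SymProd

def Near (A B : Finset ℝ) (e : ℝ) : Prop :=
  (∀ a ∈ A, ∃ b ∈ B, |a - b| ≤ e) ∧ (∀ b ∈ B, ∃ a ∈ A, |a - b| ≤ e)

lemma Near.symm {A B : Finset ℝ} {e : ℝ} (h : Near A B e) : Near B A e := by
  refine ⟨fun b hb => ?_, fun a ha => ?_⟩
  · obtain ⟨a, ha, h'⟩ := h.2 b hb
    exact ⟨a, ha, by rwa [abs_sub_comm]⟩
  · obtain ⟨b, hb, h'⟩ := h.1 a ha
    exact ⟨b, hb, by rwa [abs_sub_comm]⟩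

lemma exists_gap (N : ℕ) (hN : 2 ≤ N) (A : Finset ℝ) : ∃ d : ℝ, 0 ≤ d ∧ (A.card ≠ N → d = 0) ∧
    (A.card = N → 0 < d ∧ (∀ a ∈ A, ∀ b ∈ A, a < b → d ≤ b - a) ∧
      ∃ a ∈ A, ∃ b ∈ A, a < b ∧ d = b - a) := by
  by_cases h : A.card = N
  · have hne : ((A ×ˢ A).filter (fun p => p.1 < p.2)).Nonempty := by
      obtain ⟨a, ha, b, hb, hab⟩ := Finset.one_lt_card.1 (show 1 < A.card by omega)
      rcases lt_or_gt_of_ne hab with h' | h'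
      · exact ⟨(a, b), by simp [ha, hb, h']⟩
      · exact ⟨(b, a), by simp [ha, hb, h']⟩
    obtain ⟨p, hp, hmin⟩ := Finset.exists_min_image _ (fun p : ℝ × ℝ => p.2 - p.1) hne
    simp only [Finset.mem_filter, Finset.mem_product] at hp hmin
    refine ⟨p.2 - p.1, by linarith [hp.2], fun h' => absurd h h', fun _ => ⟨by linarith [hp.2],
      fun a ha b hb hab => hmin (a, b) ⟨⟨ha, hb⟩, hab⟩, p.1, hp.1.1, p.2, hp.1.2, hp.2, rfl⟩⟩
  · exact ⟨0, le_rfl, fun _ => rfl, fun h' => absurd h' h⟩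

noncomputable def rk (A : Finset ℝ) (a : ℝ) : ℕ := (A.filter (fun x => x < a)).card

noncomputable def mv (A : Finset ℝ) (d a : ℝ) : ℝ := a - d * (rk A a : ℝ)

lemma sep_bound (d m : ℝ) (S : Finset ℝ) :
    (∀ x ∈ S, m ≤ x) → (∀ x ∈ S, ∀ y ∈ S, x < y → d ≤ y - x) →
    ∀ a, m ≤ a → (∀ x ∈ S, d ≤ a - x) → m + d * (S.card : ℝ) ≤ a := by
  induction S using Finset.induction_on_max with
  | empty => intro _ _ a ha _; simpa using ha
  | insert M S hM ih =>
    intro h1 h2 a ha h3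
    have hn : M ∉ S := fun h => lt_irrefl _ (hM M h)
    have := ih (fun x hx => h1 x (Finset.mem_insert_of_mem hx))
      (fun x hx y hy => h2 x (Finset.mem_insert_of_mem hx) y (Finset.mem_insert_of_mem hy))
      M (h1 M (Finset.mem_insert_self _ _))
      (fun x hx => h2 x (Finset.mem_insert_of_mem hx) M (Finset.mem_insert_self _ _) (hM x hx))
    rw [Finset.card_insert_of_notMem hn]
    have h4 := h3 M (Finset.mem_insert_self _ _)
    push_cast
    linarith

lemma step (n : ℕ) (hn : 1 ≤ n) : ∃ (C : ℝ) (r : Finset ℝ → Finset ℝ), 0 ≤ C ∧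
    (∀ A, A.Nonempty → A.card ≤ n + 1 → (r A).Nonempty ∧ (r A).card ≤ n ∧
      (∀ y ∈ r A, ∃ u ∈ A, ∃ v ∈ A, u ≤ y ∧ y ≤ v) ∧ (A.card ≤ n → r A = A)) ∧
    (∀ A B, A.Nonempty → B.Nonempty → A.card ≤ n + 1 → B.card ≤ n + 1 → ∀ e, 0 ≤ e → Near A B e →
      Near (r A) (r B) (C * e)) := by
  choose D hD0 hDne hDeq using exists_gap (n + 1) (by omega)
  have hrk : ∀ A a, A.card ≤ n + 1 → (rk A a : ℝ) ≤ n + 1 := by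
    intro A a hA
    have : rk A a ≤ n + 1 := (Finset.card_filter_le _ _).trans hA
    exact_mod_cast this
  have hid : ∀ A : Finset ℝ, A.card ≤ n → A.image (mv A (D A)) = A := by
    intro A hA
    have : D A = 0 := hDne A (by omega)
    have h : mv A (D A) = id := by funext x; simp [mv, this]
    rw [h, Finset.image_id]
  have key : ∀ A B, A.card ≤ n + 1 → B.card ≤ n + 1 → ∀ e, 0 ≤ e → Near A B e → 2 * e < D A →
      Near (A.image (mv A (D A))) (B.image (mv B (D B))) ((4 * (n + 1) + 1) * e) := by
    intro A B hA hB e he hAB hlt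
    have hcA : A.card = n + 1 := by
      by_contra h
      rw [hDne A h] at hlt; linarith
    obtain ⟨hpos, hsep, a0, ha0, b0, hb0, hab0, hd0⟩ := hDeq A hcA
    have h1 := hAB.1
    choose! φ hφB hφ using h1
    have hmono : ∀ a ∈ A, ∀ b ∈ A, a < b → φ a < φ b := by
      intro a ha b hb hab
      have := hsep a ha b hb hab
      have h1 := abs_le.1 (hφ a ha)
      have h2 := abs_le.1 (hφ b hb)
      linarith
    have hinj : Set.InjOn φ (A : Set ℝ) := by
      intro a ha b hb hab
      rcases lt_trichotomy a b with h | h | h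
      · exact absurd hab (hmono a ha b hb h).ne
      · exact h
      · exact absurd hab (hmono b hb a ha h).ne'
    have hiff : ∀ a ∈ A, ∀ b ∈ A, (φ a < φ b ↔ a < b) := by
      intro a ha b hb
      refine ⟨fun h => ?_, hmono a ha b hb⟩
      by_contra h'
      rcases (not_lt.1 h').lt_or_eq with h2 | h2
      · exact lt_asymm h (hmono b hb a ha h2)
      · rw [h2] at h; exact lt_irrefl _ h
    have himg : A.image φ = B := by
      apply Finset.eq_of_subset_of_card_le
      · intro y hy
        obtain ⟨a, ha, rfl⟩ := Finset.mem_image.1 hy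
        exact hφB a ha
      · rw [Finset.card_image_of_injOn hinj]; omega
    have hcB : B.card = n + 1 := by
      rw [← himg, Finset.card_image_of_injOn hinj, hcA]
    obtain ⟨hposB, hsepB, a1, ha1, b1, hb1, hab1, hd1⟩ := hDeq B hcB
    have hr : ∀ a ∈ A, rk B (φ a) = rk A a := by
      intro a ha
      unfold rk
      have : B.filter (fun x => x < φ a) = (A.filter (fun x => x < a)).image φ := by
        ext y
        simp only [Finset.mem_filter, Finset.mem_image]
        constructor
        · rintro ⟨hy, hya⟩
          rw [← himg] at hy
          obtain ⟨x, hx, rfl⟩ := Finset.mem_image.1 hy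
          exact ⟨x, ⟨hx, (hiff x hx a ha).1 hya⟩, rfl⟩
        · rintro ⟨x, ⟨hx, hxa⟩, rfl⟩
          exact ⟨hφB x hx, hmono x hx a ha hxa⟩
      rw [this, Finset.card_image_of_injOn]
      exact hinj.mono (by intro x hx; exact (Finset.mem_filter.1 hx).1)
    have hDD : |D A - D B| ≤ 2 * e := by
      rw [← himg] at ha1 hb1
      obtain ⟨x, hx, rfl⟩ := Finset.mem_image.1 ha1
      obtain ⟨y, hy, rfl⟩ := Finset.mem_image.1 hb1
      have e1 := hsep x hx y hy ((hiff x hx y hy).1 hab1)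
      have e2 := hsepB _ (hφB a0 ha0) _ (hφB b0 hb0) (hmono a0 ha0 b0 hb0 hab0)
      have := abs_le.1 (hφ x hx)
      have := abs_le.1 (hφ y hy)
      have := abs_le.1 (hφ a0 ha0)
      have := abs_le.1 (hφ b0 hb0)
      rw [abs_le]; constructor <;> linarith
    have hfin : ∀ a ∈ A, |mv A (D A) a - mv B (D B) (φ a)| ≤ (4 * (n + 1) + 1) * e := by
      intro a ha
      have h1 : mv A (D A) a - mv B (D B) (φ a) = (a - φ a) - (D A - D B) * (rk A a : ℝ) := by
        unfold mv; rw [hr a ha]; ring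
      rw [h1]
      refine (abs_sub _ _).trans ?_
      rw [abs_mul, abs_of_nonneg (Nat.cast_nonneg (rk A a) : (0 : ℝ) ≤ rk A a)]
      have h2 : |D A - D B| * (rk A a : ℝ) ≤ 2 * e * (n + 1) :=
        mul_le_mul hDD (hrk A a hA) (Nat.cast_nonneg _) (by linarith)
      have h3 := hφ a ha
      have h4 : 0 ≤ e * (n + 1) := by positivity
      linarith
    constructor
    · intro y hy
      obtain ⟨a, ha, rfl⟩ := Finset.mem_image.1 hy
      exact ⟨_, Finset.mem_image_of_mem _ (hφB a ha), hfin a ha⟩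
    · intro y hy
      obtain ⟨b, hb, rfl⟩ := Finset.mem_image.1 hy
      rw [← himg] at hb
      obtain ⟨a, ha, rfl⟩ := Finset.mem_image.1 hb
      exact ⟨_, Finset.mem_image_of_mem _ ha, hfin a ha⟩
  refine ⟨4 * (n + 1) + 1, fun A => A.image (mv A (D A)), by positivity, ?_, ?_⟩
  · intro A hne hA
    refine ⟨hne.image _, ?_, ?_, hid A⟩
    · rcases hA.lt_or_eq with h | h
      · exact Finset.card_image_le.trans (by omega)
      · obtain ⟨hpos, hsep, a, ha, b, hb, hab, hd⟩ := hDeq A h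
        have h1 : A.filter (fun x => x < b) = insert a (A.filter (fun x => x < a)) := by
          ext x
          simp only [Finset.mem_filter, Finset.mem_insert]
          constructor
          · rintro ⟨hx, hxb⟩
            rcases lt_trichotomy x a with h | h | h
            · exact Or.inr ⟨hx, h⟩
            · exact Or.inl h
            · have := hsep x hx b hb hxb
              linarith
          · rintro (rfl | ⟨hx, hxa⟩)
            · exact ⟨ha, hab⟩
            · exact ⟨hx, hxa.trans hab⟩
        have h2 : rk A b = rk A a + 1 := by
          unfold rk
          rw [h1, Finset.card_insert_of_notMem (by simp)]
        have h3 : mv A (D A) a = mv A (D A) b := by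
          unfold mv
          rw [h2]; push_cast; linarith
        have h4 : (A.image (mv A (D A))).card ≠ A.card := by
          intro hc
          exact hab.ne (Finset.card_image_iff.1 hc ha hb h3)
        have h5 : (A.image (mv A (D A))).card ≤ A.card := Finset.card_image_le
        show (A.image (mv A (D A))).card ≤ n
        omega
    · intro y hy
      obtain ⟨a, ha, rfl⟩ := Finset.mem_image.1 hy
      have hle : mv A (D A) a ≤ a := by
        have : 0 ≤ D A * (rk A a : ℝ) := mul_nonneg (hD0 A) (Nat.cast_nonneg _)
        unfold mv; linarith
      refine ⟨A.min' hne, Finset.min'_mem _ _, a, ha, ?_, hle⟩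
      by_cases h : A.card = n + 1
      · obtain ⟨hpos, hsep, -⟩ := hDeq A h
        have := sep_bound (D A) (A.min' hne) (A.filter (fun x => x < a))
          (fun x hx => Finset.min'_le _ _ (Finset.mem_filter.1 hx).1)
          (fun x hx y hy => hsep x (Finset.mem_filter.1 hx).1 y (Finset.mem_filter.1 hy).1)
          a (Finset.min'_le _ _ ha)
          (fun x hx => hsep x (Finset.mem_filter.1 hx).1 a ha (Finset.mem_filter.1 hx).2)
        unfold mv rk
        linarith
      · have : mv A (D A) a = a := by simp [mv, hDne A h]
        rw [this]
        exact Finset.min'_le _ _ ha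
  · intro A B _ _ hA hB e he hAB
    by_cases h1 : 2 * e < D A
    · exact key A B hA hB e he hAB h1
    by_cases h2 : 2 * e < D B
    · exact (key B A hB hA e he hAB.symm h2).symm
    push Not at h1 h2
    have hmv : ∀ a b, |a - b| ≤ e →
        |mv A (D A) a - mv B (D B) b| ≤ (4 * (n + 1) + 1) * e := by
      intro a b hab
      have e1 : D A * (rk A a : ℝ) ≤ 2 * e * (n + 1) :=
        mul_le_mul h1 (hrk A a hA) (Nat.cast_nonneg _) (by linarith)
      have e2 : D B * (rk B b : ℝ) ≤ 2 * e * (n + 1) :=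
        mul_le_mul h2 (hrk B b hB) (Nat.cast_nonneg _) (by linarith)
      have e3 : 0 ≤ D A * (rk A a : ℝ) := mul_nonneg (hD0 A) (Nat.cast_nonneg _)
      have e4 : 0 ≤ D B * (rk B b : ℝ) := mul_nonneg (hD0 B) (Nat.cast_nonneg _)
      have h4 : 0 ≤ e * (n + 1) := by positivity
      have := abs_le.1 hab
      unfold mv
      rw [abs_le]; constructor <;> linarith
    constructor
    · intro y hy
      obtain ⟨a, ha, rfl⟩ := Finset.mem_image.1 hy
      obtain ⟨b, hb, hab⟩ := hAB.1 a ha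
      exact ⟨_, Finset.mem_image_of_mem _ hb, hmv a b hab⟩
    · intro y hy
      obtain ⟨b, hb, rfl⟩ := Finset.mem_image.1 hy
      obtain ⟨a, ha, hab⟩ := hAB.2 b hb
      exact ⟨_, Finset.mem_image_of_mem _ ha, hmv a b hab⟩

lemma multi (k : ℕ) (hk : 1 ≤ k) (n : ℕ) (hkn : k ≤ n) :
    ∃ (C : ℝ) (r : Finset ℝ → Finset ℝ), 0 ≤ C ∧
    (∀ A, A.Nonempty → A.card ≤ n → (r A).Nonempty ∧ (r A).card ≤ k ∧
      (∀ y ∈ r A, ∃ u ∈ A, ∃ v ∈ A, u ≤ y ∧ y ≤ v) ∧ (A.card ≤ k → r A = A)) ∧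
    (∀ A B, A.Nonempty → B.Nonempty → A.card ≤ n → B.card ≤ n → ∀ e, 0 ≤ e → Near A B e →
      Near (r A) (r B) (C * e)) := by
  induction n, hkn using Nat.le_induction with
  | base =>
    refine ⟨1, id, zero_le_one, fun A h1 h2 => ⟨h1, h2, fun y hy => ⟨y, hy, y, hy, le_rfl, le_rfl⟩,
      fun _ => rfl⟩, fun A B _ _ _ _ e _ h => by simpa using h⟩
  | succ n hkn ih =>
    obtain ⟨C, r, hC, hr, hL⟩ := ih
    obtain ⟨C', r', hC', hr', hL'⟩ := step n (hk.trans hkn)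
    refine ⟨C * C', fun A => r (r' A), by positivity, ?_, ?_⟩
    · intro A hne hA
      obtain ⟨h1, h2, h3, h4⟩ := hr' A hne hA
      obtain ⟨g1, g2, g3, g4⟩ := hr (r' A) h1 h2
      refine ⟨g1, g2, ?_, ?_⟩
      · intro y hy
        obtain ⟨u, hu, v, hv, huy, hyv⟩ := g3 y hy
        obtain ⟨u1, hu1, _, _, hu2, _⟩ := h3 u hu
        obtain ⟨_, _, v1, hv1, _, hv2⟩ := h3 v hv
        exact ⟨u1, hu1, v1, hv1, hu2.trans huy, hyv.trans hv2⟩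
      · intro hAk
        have := h4 (hAk.trans hkn)
        simp only [this] at g4 ⊢
        exact g4 hAk
    · intro A B hA hB hcA hcB e he hAB
      obtain ⟨h1, h2, -⟩ := hr' A hA hcA
      obtain ⟨g1, g2, -⟩ := hr' B hB hcB
      rw [mul_assoc]
      exact hL _ _ h1 g1 h2 g2 _ (by positivity) (hL' A B hA hB hcA hcB e he hAB)

lemma near_half {A B : Set ℝ} (hA : A.Finite) (hB : B.Finite) (hAn : A.Nonempty)
    (hBn : B.Nonempty) : ∀ a ∈ A, ∃ b ∈ B, |a - b| ≤ hausdorffDist A B := by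
  intro a ha
  obtain ⟨b, hb, h⟩ := hB.isCompact.exists_infDist_eq_dist hBn a
  refine ⟨b, hb, ?_⟩
  rw [← Real.dist_eq, ← h]
  exact infDist_le_hausdorffDist_of_mem ha
    (hausdorffEDist_ne_top_of_nonempty_of_bounded hAn hBn hA.isBounded hB.isBounded)

end SymProd

/-- **Lemma (Kovalev).** For a nonempty connected subset `X ⊆ ℝ` and `1 ≤ k < n` there is a
Lipschitz retraction from the symmetric product `X^(n)` onto `X^(k)`. -/
theorem symmetric_product_Lipschitz_retraction (X : Set ℝ) (hX : IsConnected X)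
    (k n : ℕ) (hk : 1 ≤ k) (hkn : k < n) :
    ∃ (C : ℝ) (r : {A : Set ℝ // A ⊆ X ∧ A.Finite ∧ A.Nonempty ∧ A.ncard ≤ n} →
        {A : Set ℝ // A ⊆ X ∧ A.Finite ∧ A.Nonempty ∧ A.ncard ≤ k}),
      (∀ A : {A : Set ℝ // A ⊆ X ∧ A.Finite ∧ A.Nonempty ∧ A.ncard ≤ n},
        A.1.ncard ≤ k → (r A).1 = A.1) ∧
      (∀ A B : {A : Set ℝ // A ⊆ X ∧ A.Finite ∧ A.Nonempty ∧ A.ncard ≤ n},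
        hausdorffDist (r A).1 (r B).1 ≤ C * hausdorffDist A.1 B.1) := by
  obtain ⟨C, r, hC, hr, hL⟩ := SymProd.multi k hk n hkn.le
  have hne : ∀ A : {A : Set ℝ // A ⊆ X ∧ A.Finite ∧ A.Nonempty ∧ A.ncard ≤ n},
      (A.2.2.1.toFinset).Nonempty := fun A => by simpa using A.2.2.2.1
  have hcard : ∀ A : {A : Set ℝ // A ⊆ X ∧ A.Finite ∧ A.Nonempty ∧ A.ncard ≤ n},
      (A.2.2.1.toFinset).card = A.1.ncard := fun A => (Set.ncard_eq_toFinset_card _ _).symm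
  have hcn : ∀ A : {A : Set ℝ // A ⊆ X ∧ A.Finite ∧ A.Nonempty ∧ A.ncard ≤ n},
      (A.2.2.1.toFinset).card ≤ n := fun A => (hcard A).trans_le A.2.2.2.2
  refine ⟨C, fun A => ⟨(r A.2.2.1.toFinset : Set ℝ), ?_, Finset.finite_toSet _, ?_, ?_⟩, ?_, ?_⟩
  · intro y hy
    obtain ⟨u, hu, v, hv, huy, hyv⟩ := (hr _ (hne A) (hcn A)).2.2.1 y hy
    exact hX.isPreconnected.ordConnected.out (A.2.1 (by simpa using hu)) (A.2.1 (by simpa using hv))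
      ⟨huy, hyv⟩
  · exact_mod_cast (hr _ (hne A) (hcn A)).1
  · rw [Set.ncard_coe_finset]
    exact (hr _ (hne A) (hcn A)).2.1
  · intro A hA
    have := (hr _ (hne A) (hcn A)).2.2.2 ((hcard A).trans_le hA)
    simp [this]
  · intro A B
    have hnear : SymProd.Near A.2.2.1.toFinset B.2.2.1.toFinset (hausdorffDist A.1 B.1) := by
      constructor
      · intro a ha
        obtain ⟨b, hb, h⟩ := SymProd.near_half A.2.2.1 B.2.2.1 A.2.2.2.1 B.2.2.2.1 a (by simpa using ha)
        exact ⟨b, by simpa using hb, h⟩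
      · intro b hb
        obtain ⟨a, ha, h⟩ := SymProd.near_half B.2.2.1 A.2.2.1 B.2.2.2.1 A.2.2.2.1 b (by simpa using hb)
        exact ⟨a, by simpa using ha, by rwa [abs_sub_comm, hausdorffDist_comm]⟩
    have h := hL _ _ (hne A) (hne B) (hcn A) (hcn B) _ hausdorffDist_nonneg hnear
    refine hausdorffDist_le_of_mem_dist (mul_nonneg hC hausdorffDist_nonneg) ?_ ?_
    · intro x hx
      obtain ⟨b, hb, h'⟩ := h.1 x hx
      exact ⟨b, hb, h'⟩
    · intro x hx
      obtain ⟨b, hb, h'⟩ := h.2 x hx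
      exact ⟨b, hb, by rwa [dist_comm]⟩
end

section
/- Fix an integer n ≥ 2. For a nonempty finite subset A of ℝ of cardinality at most n, define δ(A) as follows: if A has exactly n elements a₁ < a₂ < ⋯ < a_n, set δ(A) = min{a_j − a_{j−1} : j = 2, …, n}; if A has fewer than n elements, set δ(A) = 0. Then for all nonempty subsets A, B of ℝ of cardinality at most n, |δ(A) − δ(B)| ≤ 2·d_H(A,B). -/
open Metric

/-- The minimal gap of a set of reals: the infimum of distances between distinct elements. -/
noncomputable def minGap (A : Set ℝ) : ℝ :=
  sInf {r : ℝ | ∃ a ∈ A, ∃ b ∈ A, a ≠ b ∧ r = |a - b|}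

/-- `δ(A)`: the minimal gap of `A` if `A` has exactly `n` elements, and `0` otherwise. -/
noncomputable def gapδ (n : ℕ) (A : Set ℝ) : ℝ :=
  if A.ncard = n then minGap A else 0

theorem minGap_nonneg' (A : Set ℝ) : 0 ≤ minGap A := by
  apply Real.sInf_nonneg
  rintro r ⟨a, _, b, _, _, rfl⟩
  exact abs_nonneg _

theorem minGap_le' {A : Set ℝ} {a b : ℝ} (ha : a ∈ A) (hb : b ∈ A) (h : a ≠ b) :
    minGap A ≤ |a - b| := by
  apply csInf_le
  · refine ⟨0, ?_⟩
    rintro r ⟨a, _, b, _, _, rfl⟩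
    exact abs_nonneg _
  · exact ⟨a, ha, b, hb, h, rfl⟩

theorem gapδ_nonneg' (n : ℕ) (A : Set ℝ) : 0 ≤ gapδ n A := by
  unfold gapδ
  split_ifs
  · exact minGap_nonneg' A
  · exact le_rfl

theorem gapδ_aux (n : ℕ) (hn : 2 ≤ n) (A B : Set ℝ)
    (hAfin : A.Finite) (hAne : A.Nonempty)
    (hBfin : B.Finite) (hBne : B.Nonempty) (hBcard : B.ncard ≤ n) :
    gapδ n A ≤ gapδ n B + 2 * hausdorffDist A B := by
  have hd : 0 ≤ hausdorffDist A B := hausdorffDist_nonneg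
  have hB0 := gapδ_nonneg' n B
  by_cases hA : A.ncard = n
  swap
  · have : gapδ n A = 0 := by simp [gapδ, hA]
    linarith
  have hAe : gapδ n A = minGap A := by simp [gapδ, hA]
  have fin := hausdorffEDist_ne_top_of_nonempty_of_bounded hAne hBne
    hAfin.isBounded hBfin.isBounded
  refine le_of_forall_pos_le_add fun ε hε => ?_
  have key : ∀ x : ℝ, ∃ y, x ∈ A → y ∈ B ∧ dist x y < hausdorffDist A B + ε / 2 := by
    intro x
    by_cases hx : x ∈ A
    · obtain ⟨y, hy, h⟩ := exists_dist_lt_of_hausdorffDist_lt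
        (r := hausdorffDist A B + ε / 2) hx (by linarith) fin
      exact ⟨y, fun _ => ⟨hy, h⟩⟩
    · exact ⟨0, fun h => absurd h hx⟩
  choose f hf using key
  have hclose : ∀ a ∈ A, ∀ b ∈ A, |a - b| ≤ |f a - f b| + 2 * hausdorffDist A B + ε := by
    intro a ha b hb
    have h1 := (hf a ha).2
    have h2 := (hf b hb).2
    have h3 := dist_triangle4 a (f a) (f b) b
    rw [dist_comm (f b) b] at h3
    rw [← Real.dist_eq, ← Real.dist_eq]
    linarith
  by_cases hinj : Set.InjOn f A
  · have hsub : f '' A ⊆ B := by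
      rintro _ ⟨a, ha, rfl⟩
      exact (hf a ha).1
    have hc : (f '' A).ncard = n := by rw [Set.ncard_image_of_injOn hinj, hA]
    have heq : f '' A = B := Set.eq_of_subset_of_ncard_le hsub (by omega) hBfin
    have hBe : gapδ n B = minGap B := by
      rw [heq] at hc
      simp [gapδ, hc]
    have : minGap A - 2 * hausdorffDist A B - ε ≤ minGap B := by
      apply le_csInf
      · obtain ⟨a, ha, b, hb, hab⟩ := (Set.one_lt_ncard hBfin).1
          (by rw [← heq, hc]; omega)
        exact ⟨_, a, ha, b, hb, hab, rfl⟩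
      · rintro r ⟨b, hb, b', hb', hne, rfl⟩
        rw [← heq] at hb hb'
        obtain ⟨a, ha, rfl⟩ := hb
        obtain ⟨a', ha', rfl⟩ := hb'
        have h1 := hclose a ha a' ha'
        have h2 := minGap_le' ha ha' (fun h => hne (by rw [h]))
        linarith
    linarith
  · simp only [Set.InjOn, not_forall] at hinj
    obtain ⟨a, ha, b, hb, hab, hne⟩ := hinj
    have h1 := hclose a ha b hb
    have h2 := minGap_le' ha hb hne
    rw [hab, sub_self, abs_zero] at h1
    linarith

/-- **Estimate (2.1) of Kovalev.** The minimal-gap functional `δ` on nonempty sets of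
cardinality at most `n` is 2-Lipschitz with respect to the Hausdorff distance. -/
theorem gapδ_lipschitz (n : ℕ) (hn : 2 ≤ n) (A B : Set ℝ)
    (hAfin : A.Finite) (hAne : A.Nonempty) (hAcard : A.ncard ≤ n)
    (hBfin : B.Finite) (hBne : B.Nonempty) (hBcard : B.ncard ≤ n) :
    |gapδ n A - gapδ n B| ≤ 2 * hausdorffDist A B := by
  have h1 := gapδ_aux n hn A B hAfin hAne hBfin hBne hBcard
  have h2 := gapδ_aux n hn B A hBfin hBne hAfin hAne hAcard
  rw [hausdorffDist_comm] at h2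
  rw [abs_le]
  constructor <;> linarith
end

section
/- Let X and Y be metric spaces with diam X = D < ∞, let n ≥ 2 and L > 0, and let f : X → Y^(n) be an L-Lipschitz map (with respect to the Hausdorff metric on Y^(n)). Suppose there exists x₀ ∈ X with diam f(x₀) > 3·L·D·(n−1). Then there exist L-Lipschitz maps g, h : X → Y^(n−1) such that f(x) = g(x) ∪ h(x) for all x ∈ X. -/
open Metric

lemma aux_gap (S : Finset ℝ) (r : ℝ) (h0 : (0:ℝ) ∈ S) (hpos : ∀ x ∈ S, 0 ≤ x) (M : ℝ) (hM : M ∈ S)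
    (hr : 0 ≤ r) (hgap : r * ((S.card : ℝ) - 1) < M) :
    ∃ t ∈ S, t < M ∧ ∀ s ∈ S, s ≤ t ∨ t + r < s := by
  by_contra hcon
  push Not at hcon
  have key : ∀ k : ℕ, ∀ x ∈ S, x ≤ M → (S.filter (· < x)).card = k → x ≤ r * k := by
    intro k
    induction k using Nat.strong_induction_on with
    | _ k ih =>
      intro x hx hxM hk
      rcases (hpos x hx).eq_or_lt with h | h
      · rw [← h]; positivity
      have hne : (S.filter (· < x)).Nonempty := ⟨0, by simp [h0, h]⟩
      obtain ⟨t, ht, hmax⟩ := (S.filter (· < x)).exists_max_image id hne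
      simp only [Finset.mem_filter, id] at ht hmax
      obtain ⟨s, hs, hts, hsr⟩ := hcon t ht.1 (by linarith)
      have hxs : x ≤ s := by
        by_contra hlt
        have := hmax s ⟨hs, by linarith⟩
        linarith
      have hlt : (S.filter (· < t)).card < k := by
        rw [← hk]
        apply Finset.card_lt_card
        rw [Finset.ssubset_iff_of_subset]
        · exact ⟨t, by simp [ht], by simp⟩
        · intro u hu
          simp only [Finset.mem_filter] at hu ⊢
          exact ⟨hu.1, by linarith⟩
      have h1 := ih _ hlt t ht.1 (by linarith) rfl
      have h2 : ((S.filter (· < t)).card : ℝ) + 1 ≤ k := by exact_mod_cast hlt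
      nlinarith
  have h1 := key _ M hM le_rfl rfl
  have h2 : (S.filter (· < M)).card < S.card := by
    apply Finset.card_lt_card
    rw [Finset.ssubset_iff_of_subset (Finset.filter_subset _ _)]
    exact ⟨M, hM, by simp⟩
  have h3 : ((S.filter (· < M)).card : ℝ) + 1 ≤ S.card := by exact_mod_cast h2
  nlinarith

lemma aux_split {Y : Type*} [MetricSpace Y] (A : Set Y) (hA : A.Finite) (n : ℕ)
    (hn : A.ncard ≤ n) (h1 : 1 ≤ n) (r : ℝ) (hr : 0 ≤ r) (h : r * ((n : ℝ) - 1) < Metric.diam A) :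
    ∃ B C : Set Y, B.Nonempty ∧ C.Nonempty ∧ A = B ∪ C ∧ ∀ b ∈ B, ∀ c ∈ C, r < dist b c := by
  classical
  have hn1 : (1:ℝ) ≤ n := by exact_mod_cast h1
  have : ∃ p ∈ A, ∃ q ∈ A, r * ((n : ℝ) - 1) < dist p q := by
    by_contra hc
    push Not at hc
    have := Metric.diam_le_of_forall_dist_le (s := A) (C := r * ((n : ℝ) - 1))
      (mul_nonneg hr (by linarith)) hc
    linarith
  obtain ⟨p, hp, q, hq, hpq⟩ := this
  obtain ⟨t, ht, htM, hs⟩ := aux_gap (hA.toFinset.image (dist p)) r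
    (Finset.mem_image.2 ⟨p, by simpa using hp, dist_self p⟩)
    (by intro x hx; obtain ⟨y, -, rfl⟩ := Finset.mem_image.1 hx; exact dist_nonneg)
    (dist p q) (Finset.mem_image.2 ⟨q, by simpa using hq, rfl⟩) hr (by
      have h1 : (hA.toFinset.image (dist p)).card ≤ n :=
        Finset.card_image_le.trans (by rwa [← Set.ncard_eq_toFinset_card A hA])
      have h2 : ((hA.toFinset.image (dist p)).card : ℝ) ≤ n := by exact_mod_cast h1
      nlinarith)
  refine ⟨{y ∈ A | dist p y ≤ t}, {y ∈ A | ¬ dist p y ≤ t}, ?_, ⟨q, hq, by simpa using htM⟩, ?_, ?_⟩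
  · obtain ⟨y, hy, rfl⟩ := Finset.mem_image.1 ht
    exact ⟨y, by simpa using hy, le_rfl⟩
  · ext y
    simp only [Set.mem_union, Set.mem_setOf_eq]
    tauto
  · rintro b ⟨hb, hbt⟩ c ⟨hc, hct⟩
    have := (hs (dist p c) (Finset.mem_image.2 ⟨c, by simpa using hc, rfl⟩)).resolve_left hct
    have := dist_triangle p b c
    linarith

lemma aux_near_s16 {Y : Type*} [MetricSpace Y] {A B : Set Y} (hA : A.Finite) (hB : B.Finite)
    (hB' : B.Nonempty) {a : Y} (ha : a ∈ A) {r : ℝ} (h : hausdorffDist A B ≤ r) :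
    ∃ b ∈ B, dist a b ≤ r := by
  obtain ⟨b, hb, hab⟩ := hB.isCompact.exists_infDist_eq_dist hB' a
  refine ⟨b, hb, ?_⟩
  rw [← hab]
  exact (infDist_le_hausdorffDist_of_mem ha (hausdorffEDist_ne_top_of_nonempty_of_bounded
    ⟨a, ha⟩ hB' hA.isBounded hB.isBounded)).trans h


/-- **Lipschitz decomposition lemma (after De Lellis–Spadaro).** If `X` has finite diameter
`D`, `f : X → Y^(n)` is `L`-Lipschitz, and `diam f(x₀) > 3LD(n-1)` for some `x₀`, then `f`
splits as a union `f = g ∪ h` of two `L`-Lipschitz maps into `Y^(n-1)`. -/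
theorem lipschitz_decomposition (X Y : Type*) [MetricSpace X] [MetricSpace Y]
    (n : ℕ) (hn : 2 ≤ n) (D L : ℝ) (hL : 0 < L)
    (hbdd : Bornology.IsBounded (Set.univ : Set X))
    (hD : Metric.diam (Set.univ : Set X) = D)
    (f : X → {A : Set Y // A.Finite ∧ A.Nonempty ∧ A.ncard ≤ n})
    (hf : ∀ x₁ x₂ : X, hausdorffDist (f x₁).1 (f x₂).1 ≤ L * dist x₁ x₂)
    (x₀ : X) (hx₀ : 3 * L * D * ((n : ℝ) - 1) < Metric.diam (f x₀).1) :
    ∃ (g h : X → {A : Set Y // A.Finite ∧ A.Nonempty ∧ A.ncard ≤ n - 1}),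
      (∀ x₁ x₂ : X, hausdorffDist (g x₁).1 (g x₂).1 ≤ L * dist x₁ x₂) ∧
      (∀ x₁ x₂ : X, hausdorffDist (h x₁).1 (h x₂).1 ≤ L * dist x₁ x₂) ∧
      (∀ x : X, (f x).1 = (g x).1 ∪ (h x).1) := by

  have hdist : ∀ x₁ x₂ : X, L * dist x₁ x₂ ≤ L * D := fun x₁ x₂ => by
    rw [← hD]
    exact mul_le_mul_of_nonneg_left
      (dist_le_diam_of_mem hbdd (Set.mem_univ _) (Set.mem_univ _)) hL.le
  have hLD : 0 ≤ L * D := (by simpa using hdist x₀ x₀)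
  obtain ⟨B, C, hB, hC, hBC, hsep⟩ := aux_split (f x₀).1 (f x₀).2.1 n (f x₀).2.2.2 (by omega)
    (3 * L * D) (by linarith) hx₀
  have near : ∀ x₁ x₂ : X, ∀ y ∈ (f x₁).1, ∃ z ∈ (f x₂).1, dist y z ≤ L * dist x₁ x₂ :=
    fun x₁ x₂ y hy => aux_near_s16 (f x₁).2.1 (f x₂).2.1 (f x₂).2.2.1 hy (hf x₁ x₂)
  have sub : ∀ B C : Set Y, B.Nonempty → C.Nonempty → (f x₀).1 = B ∪ C →
      (∀ b ∈ B, ∀ c ∈ C, 3 * L * D < dist b c) →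
      ∃ g : X → {A : Set Y // A.Finite ∧ A.Nonempty ∧ A.ncard ≤ n - 1},
        (∀ x₁ x₂ : X, hausdorffDist (g x₁).1 (g x₂).1 ≤ L * dist x₁ x₂) ∧
        ∀ x, (g x).1 = {y ∈ (f x).1 | ∃ b ∈ B, dist y b ≤ L * D} := by
    intro B C hB hC hBC hsep
    have cover : ∀ x, ∀ y ∈ (f x).1, (∃ b ∈ B, dist y b ≤ L * D) ∨ ∃ c ∈ C, dist y c ≤ L * D := by
      intro x y hy
      obtain ⟨z, hz, hyz⟩ := near x x₀ y hy
      have := hyz.trans (hdist _ _)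
      rw [hBC] at hz
      rcases hz with hz | hz
      · exact Or.inl ⟨z, hz, this⟩
      · exact Or.inr ⟨z, hz, this⟩
    have hit : ∀ x, ∀ b ∈ (f x₀).1, ∃ y ∈ (f x).1, dist y b ≤ L * D := by
      intro x b hb
      obtain ⟨z, hz, hyz⟩ := near x₀ x b hb
      exact ⟨z, hz, by rw [dist_comm]; exact hyz.trans (hdist _ _)⟩
    have step : ∀ x₁ x₂ : X, ∀ y ∈ {y ∈ (f x₁).1 | ∃ b ∈ B, dist y b ≤ L * D},
        ∃ z ∈ {y ∈ (f x₂).1 | ∃ b ∈ B, dist y b ≤ L * D}, dist y z ≤ L * dist x₁ x₂ := by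
      rintro x₁ x₂ y ⟨hy, b, hb, hyb⟩
      obtain ⟨z, hz, hyz⟩ := near x₁ x₂ y hy
      refine ⟨z, ⟨hz, ?_⟩, hyz⟩
      refine (cover x₂ z hz).resolve_right ?_
      rintro ⟨c, hc, hzc⟩
      have h1 := hsep b hb c hc
      have h2 := dist_triangle4 b y z c
      rw [dist_comm b y] at h2
      have h3 := hdist x₁ x₂
      linarith
    refine ⟨fun x => ⟨{y ∈ (f x).1 | ∃ b ∈ B, dist y b ≤ L * D},
      (f x).2.1.subset (Set.sep_subset _ _), ?_, ?_⟩, ?_, fun x => rfl⟩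
    · obtain ⟨b, hb⟩ := hB
      obtain ⟨y, hy, hyb⟩ := hit x b (hBC ▸ Or.inl hb)
      exact ⟨y, hy, b, hb, hyb⟩
    · obtain ⟨c, hc⟩ := hC
      obtain ⟨y, hy, hyc⟩ := hit x c (hBC ▸ Or.inr hc)
      have hlt : {y ∈ (f x).1 | ∃ b ∈ B, dist y b ≤ L * D}.ncard < (f x).1.ncard := by
        refine Set.ncard_lt_ncard ?_ (f x).2.1
        refine (Set.ssubset_iff_of_subset (Set.sep_subset _ _)).2 ⟨y, hy, ?_⟩
        rintro ⟨-, b, hb, hyb⟩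
        have h1 := hsep b hb c hc
        have h2 := dist_triangle_left b c y
        linarith
      have := (f x).2.2.2
      omega
    · intro x₁ x₂
      refine hausdorffDist_le_of_mem_dist (mul_nonneg hL.le dist_nonneg) (step x₁ x₂) ?_
      intro y hy
      rw [dist_comm x₁ x₂]
      exact step x₂ x₁ y hy
  obtain ⟨g, hg, hg'⟩ := sub B C hB hC hBC hsep
  obtain ⟨h, hh, hh'⟩ := sub C B hC hB (hBC.trans (Set.union_comm _ _))
    (fun c hc b hb => by rw [dist_comm]; exact hsep b hb c hc)
  refine ⟨g, h, hg, hh, fun x => ?_⟩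
  rw [hg', hh']
  ext y
  constructor
  · intro hy
    obtain ⟨z, hz, hyz⟩ := near x x₀ y hy
    have := hyz.trans (hdist _ _)
    rw [hBC] at hz
    rcases hz with hz | hz
    · exact Or.inl ⟨hy, z, hz, this⟩
    · exact Or.inr ⟨hy, z, hz, this⟩
  · rintro (h | h) <;> exact h.1
end
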